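/- arXiv:1905.13684 — 2 statements merged into one kernel-verified Lean document; each statement's English description precedes it below -/
import Mathlib

section
/- (Key reverse Hölder lemma.) Let d, n ≥ 1 and 1 ≤ q < p < ∞. Assume W is a matrix A_q weight on ℝ^d (with the A₁ definition if q = 1), and set r = 1 + 1/(2^{d+11} [W]_{A_{q,∞}^{sc}}). Then there is a constant c depending only on n, p, q such that for every cube Q and a.e. y ∈ Q: ((1/|Q|)∫_Q ‖W(x)^{1/p} W(y)^{−1/p}‖^{rp} dx)^{1/(rp)} ≤ c · ((1/|Q|)∫_Q ‖W(x)^{1/q} W(y)^{−1/q}‖^{q} dx)^{1/p}. -/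
open MeasureTheory ENNReal
open scoped ComplexOrder

noncomputable section

abbrev Rd (d : ℕ) := EuclideanSpace ℝ (Fin d)
abbrev Mat (n : ℕ) := Matrix (Fin n) (Fin n) ℂ
abbrev Vec (n : ℕ) := EuclideanSpace ℂ (Fin n)

/-- A cube in `ℝ^d` with sides parallel to the coordinate axes, given by its
lower-left corner and (positive) side length. -/
structure Cube (d : ℕ) where
  corner : Rd d
  side : ℝ
  side_pos : 0 < side

namespace Cube

/-- The underlying set of the cube. -/
def set {d : ℕ} (Q : Cube d) : Set (Rd d) :=
  {x | ∀ i, Q.corner i ≤ x i ∧ x i ≤ Q.corner i + Q.side}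

/-- The concentric triple `3Q` of a cube. -/
def triple {d : ℕ} (Q : Cube d) : Set (Rd d) :=
  {x | ∀ i, Q.corner i - Q.side ≤ x i ∧ x i ≤ Q.corner i + 2 * Q.side}

end Cube

/-- Operator norm of an `n × n` complex matrix acting on `ℂⁿ` with the Euclidean norm. -/
def opNorm {n : ℕ} (A : Mat n) : ℝ := ‖Matrix.toEuclideanCLM (𝕜 := ℂ) (n := Fin n) A‖

/-- A matrix acting on a Euclidean vector. -/
def mvec {n : ℕ} (A : Mat n) (v : Vec n) : Vec n := Matrix.toEuclideanLin A v

/-- Fractional power of a Hermitian matrix via the spectral calculus (junk value `1`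
for non-Hermitian matrices). -/
def matPow {n : ℕ} (A : Mat n) (s : ℝ) : Mat n :=
  if h : A.IsHermitian then
    (h.eigenvectorUnitary : Mat n) *
      Matrix.diagonal (fun i => ((h.eigenvalues i ^ s : ℝ) : ℂ)) *
      star (h.eigenvectorUnitary : Mat n)
  else 1

/-- A matrix weight: measurable, positive definite (hence Hermitian) a.e. -/
def IsMatrixWeight {d n : ℕ} (W : Rd d → Mat n) : Prop :=
  (∀ i j, Measurable fun x => W x i j) ∧ ∀ᵐ x : Rd d, (W x).PosDef


/-- Componentwise measurability of a `ℂⁿ`-valued function. -/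
def MeasurableV {d n : ℕ} (f : Rd d → Vec n) : Prop := ∀ i, Measurable fun x => f x i
/-- The matrix `A₁` characteristic of `W`. -/
def A1Const {d n : ℕ} (W : Rd d → Mat n) : ℝ≥0∞ :=
  ⨆ Q : Cube d,
    essSup (fun y => (volume Q.set)⁻¹ *
      ∫⁻ x in Q.set, ENNReal.ofReal (opNorm (W x * (W y)⁻¹))) (volume.restrict Q.set)

/-- The matrix `A_q` characteristic of `W`, `1 < q < ∞`. -/
def AqConst {d n : ℕ} (W : Rd d → Mat n) (q : ℝ) : ℝ≥0∞ :=
  ⨆ Q : Cube d, (volume Q.set)⁻¹ * ∫⁻ x in Q.set,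
    ((volume Q.set)⁻¹ * ∫⁻ y in Q.set,
        ENNReal.ofReal (opNorm (matPow (W x) (1/q) * matPow (W y) (-(1/q)))) ^ (q/(q-1))) ^ (q-1)

/-- Hardy–Littlewood maximal operator (over cubes) of an `ℝ≥0∞`-valued function. -/
def HLM {d : ℕ} (g : Rd d → ℝ≥0∞) (x : Rd d) : ℝ≥0∞ :=
  ⨆ (Q : Cube d) (_ : x ∈ Q.set), (volume Q.set)⁻¹ * ∫⁻ y in Q.set, g y

/-- The Fujii–Wilson `A∞` characteristic of a scalar weight `w`. -/
def AInftyConst {d : ℕ} (w : Rd d → ℝ≥0∞) : ℝ≥0∞ :=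
  ⨆ Q : Cube d, (∫⁻ x in Q.set, w x)⁻¹ * ∫⁻ x in Q.set, HLM (Q.set.indicator w) x

/-- The scalar `A_{q,∞}` characteristic of a matrix weight `W`. -/
def AqScConst {d n : ℕ} (W : Rd d → Mat n) (q : ℝ) : ℝ≥0∞ :=
  ⨆ e : Vec n, AInftyConst (fun x => (‖mvec (matPow (W x) (1/q)) e‖₊ : ℝ≥0∞) ^ q)

section CStar

variable {A : Type*} [CStarAlgebra A] [PartialOrder A] [StarOrderedRing A]

lemma cfc_smul_rpow {a : A} (ha : 0 ≤ a) {r : ℝ} (hr : 0 ≤ r) {y : ℝ} (hy : 0 ≤ y) :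
    (r • a) ^ y = r ^ y • a ^ y := by
  rw [CFC.rpow_eq_cfc_real (a := r • a) (smul_nonneg hr ha), CFC.rpow_eq_cfc_real ha]
  have hc : Continuous fun x : ℝ => x ^ y := Real.continuous_rpow_const hy
  rw [← cfc_comp_const_mul r (fun x : ℝ => x ^ y) a hc.continuousOn,
    ← cfc_smul (r ^ y) (fun x : ℝ => x ^ y) a hc.continuousOn]
  refine cfc_congr fun x hx => ?_
  simp [Real.mul_rpow hr (spectrum_nonneg_of_nonneg ha hx)]

/-- The Cordes inequality for strictly positive elements. -/
lemma cordes_rpow {a b : A} (ha : IsStrictlyPositive a) (hb : IsStrictlyPositive b)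
    {s t : ℝ} (hs : 0 < s) (hst : s ≤ t) :
    ‖a ^ s * b ^ (-s)‖ ≤ ‖a ^ t * b ^ (-t)‖ ^ (s / t) := by
  have ht : 0 < t := hs.trans_le hst
  have hθ : 0 ≤ s / t := by positivity
  have sa (x : A) (u : ℝ) : star (x ^ u) = x ^ u := (CFC.rpow_nonneg (a := x) (y := u)).isSelfAdjoint
  set l := ‖a ^ t * b ^ (-t)‖ with hl
  have hl0 : 0 ≤ l := norm_nonneg _
  have h1 : star (a ^ t * b ^ (-t)) * (a ^ t * b ^ (-t)) ≤ algebraMap ℝ A (l ^ 2) :=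
    CStarAlgebra.star_mul_le_algebraMap_norm_sq
  have h2 : a ^ (2 * t) ≤ (l ^ 2) • b ^ (2 * t) := by
    have h := star_left_conjugate_le_conjugate h1 (b ^ t)
    have e1 : star (b ^ t) * (star (a ^ t * b ^ (-t)) * (a ^ t * b ^ (-t))) * b ^ t
        = a ^ (2 * t) := by
      have e2 := CFC.rpow_neg_mul_rpow t hb
      have e3 := CFC.rpow_mul_rpow_neg t hb
      have e4 : a ^ (2 * t) = a ^ t * a ^ t := by
        rw [two_mul, CFC.rpow_add ha.isUnit]
      rw [star_mul, sa, sa, sa, e4]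
      calc _ = (b ^ t * b ^ (-t)) * (a ^ t * a ^ t) * (b ^ (-t) * b ^ t) := by noncomm_ring
        _ = _ := by rw [e2, e3]; simp
    rw [e1, sa] at h
    refine h.trans_eq ?_
    rw [Algebra.algebraMap_eq_smul_one, two_mul, CFC.rpow_add hb.isUnit]
    simp
  have h3 : a ^ (2 * s) ≤ (l ^ 2) ^ (s / t) • b ^ (2 * s) := by
    have h := CFC.rpow_le_rpow (p := s / t) ⟨hθ, (div_le_one ht).2 hst⟩ h2
    rw [cfc_smul_rpow CFC.rpow_nonneg (by positivity) hθ,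
      CFC.rpow_rpow_of_exponent_nonneg _ _ _ (by positivity) hθ ha.nonneg,
      CFC.rpow_rpow_of_exponent_nonneg _ _ _ (by positivity) hθ hb.nonneg] at h
    have : 2 * t * (s / t) = 2 * s := by field_simp
    rwa [this] at h
  have h4 : star (a ^ s * b ^ (-s)) * (a ^ s * b ^ (-s)) ≤
      algebraMap ℝ A ((l ^ 2) ^ (s / t)) := by
    have h := star_left_conjugate_le_conjugate h3 (b ^ (-s))
    have e1 : star (b ^ (-s)) * (a ^ (2 * s)) * b ^ (-s)
        = star (a ^ s * b ^ (-s)) * (a ^ s * b ^ (-s)) := by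
      rw [two_mul, CFC.rpow_add ha.isUnit, star_mul, sa, sa]
      noncomm_ring
    rw [e1] at h
    refine h.trans_eq ?_
    rw [sa, two_mul, CFC.rpow_add hb.isUnit, Algebra.algebraMap_eq_smul_one]
    have e2 := CFC.rpow_neg_mul_rpow s hb
    have e3 := CFC.rpow_mul_rpow_neg s hb
    rw [mul_smul_comm, smul_mul_assoc, ← mul_assoc, e2, one_mul, e3]
  have h5 := (CStarAlgebra.norm_le_iff_le_algebraMap _ (by positivity)
    (star_mul_self_nonneg _)).2 h4
  rw [CStarRing.norm_star_mul_self, ← pow_two, ← Real.rpow_natCast, ← Real.rpow_natCast,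
    ← Real.rpow_mul hl0, mul_comm, Real.rpow_mul hl0] at h5
  exact (Real.rpow_le_rpow_iff (norm_nonneg _) (by positivity) (by norm_num)).1 h5

end CStar

section MatrixPower

open scoped Matrix.Norms.L2Operator MatrixOrder

variable {n : ℕ}

lemma matPow_eq_rpow {A : Mat n} (hA : A.PosDef) (s : ℝ) : matPow A s = A ^ s := by
  rw [CFC.rpow_eq_cfc_real hA.posSemidef.nonneg, hA.isHermitian.cfc_eq, matPow,
    dif_pos hA.isHermitian]
  rfl

lemma opNorm_eq_norm (A : Mat n) : opNorm A = ‖A‖ := rfl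

/-- The Cordes inequality for fractional powers of positive definite matrices. -/
lemma opNorm_matPow_mul_le {A B : Mat n} (hA : A.PosDef) (hB : B.PosDef)
    {s t : ℝ} (hs : 0 < s) (hst : s ≤ t) :
    opNorm (matPow A s * matPow B (-s)) ≤
      opNorm (matPow A t * matPow B (-t)) ^ (s / t) := by
  simp only [matPow_eq_rpow hA, matPow_eq_rpow hB, opNorm_eq_norm]
  exact cordes_rpow hA.isStrictlyPositive hB.isStrictlyPositive hs hst

lemma opNorm_le_sum_basis (A : Mat n) :
    opNorm A ≤ ∑ i, ‖mvec A (EuclideanSpace.single i 1)‖ := by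
  refine ContinuousLinearMap.opNorm_le_bound _ (by positivity) fun v => ?_
  have hv : v = ∑ i, v i • EuclideanSpace.single i (1 : ℂ) := by
    simpa using ((EuclideanSpace.basisFun (Fin n) ℂ).sum_repr v).symm
  conv_lhs => rw [hv]
  rw [map_sum, Finset.sum_mul]
  refine (norm_sum_le _ _).trans (Finset.sum_le_sum fun i _ => ?_)
  rw [map_smul, norm_smul, mul_comm]
  exact mul_le_mul_of_nonneg_left (PiLp.norm_apply_le v i) (norm_nonneg _)

lemma norm_mvec_le (A : Mat n) (v : Vec n) : ‖mvec A v‖ ≤ opNorm A * ‖v‖ :=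
  (Matrix.toEuclideanCLM (𝕜 := ℂ) (n := Fin n) A).le_opNorm v

lemma mvec_mul (A B : Mat n) (v : Vec n) : mvec (A * B) v = mvec A (mvec B v) := by
  simp [mvec, Matrix.toLpLin_apply]

lemma aemeasurable_norm_mvec_matPow {d : ℕ} {W : Rd d → Mat n} (hW : IsMatrixWeight W)
    (s : ℝ) (e : Vec n) : AEMeasurable fun x => ‖mvec (matPow (W x) s) e‖₊ := by
  let : MeasurableSpace (Mat n) := inferInstanceAs (MeasurableSpace (Fin n → Fin n → ℂ))
  have : BorelSpace (Mat n) := inferInstanceAs (BorelSpace (Fin n → Fin n → ℂ))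
  have hWm : Measurable W := measurable_pi_iff.2 fun i => measurable_pi_iff.2 fun j => hW.1 i j
  set S : Set (Mat n) := {A | IsStrictlyPositive A} with hS
  have hSm : MeasurableSet S := by
    have : S = {A | 0 ≤ A} ∩ {A | IsUnit A} := by
      ext A
      exact IsStrictlyPositive.iff_of_unital
    rw [this]
    exact CStarAlgebra.isClosed_nonneg.measurableSet.inter Units.isOpen.measurableSet
  have hφ : ContinuousOn (fun A : Mat n => ‖mvec (A ^ s) e‖₊) S := by
    have h1 : Continuous fun B : Mat n => ‖mvec B e‖₊ := by
      refine continuous_nnnorm.comp ?_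
      exact (LinearMap.continuous_of_finiteDimensional
        ((LinearMap.applyₗ e).comp (Matrix.toEuclideanLin (𝕜 := ℂ) (m := Fin n)
          (n := Fin n)).toLinearMap))
    exact h1.comp_continuousOn (CFC.continuousOn_rpow s)
  classical
  have hm : Measurable (S.piecewise (fun A : Mat n => ‖mvec (A ^ s) e‖₊) fun _ => 0) :=
    hφ.measurable_piecewise continuousOn_const hSm
  refine ⟨_, hm.comp hWm, ?_⟩
  filter_upwards [hW.2] with x hx
  have : W x ∈ S := hx.isStrictlyPositive
  simp [this, matPow_eq_rpow hx]

end MatrixPower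

section AtomAverages

open scoped NNReal

variable {X ι : Type*} [MeasurableSpace X]

/-- The average of `w` over the fibre of `idx` through a point. -/
def fiberAvg (μ : Measure X) (idx : X → ι) (w : X → ℝ≥0∞) (x : X) : ℝ≥0∞ :=
  (μ (idx ⁻¹' {idx x}))⁻¹ * ∫⁻ y in idx ⁻¹' {idx x}, w y ∂μ

/-- The running maximum of the averages over the fibres of `idx 0, …, idx N`. -/
def runMax (μ : Measure X) (idx : ℕ → X → ι) (w : X → ℝ≥0∞) (N : ℕ) (x : X) : ℝ≥0∞ :=
  partialSups (fun k => fiberAvg μ (idx k) w x) N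

lemma mul_rpow_sub_rpow_le {a b : ℝ≥0∞} {D : ℝ≥0} {ε : ℝ} (hε : 0 ≤ ε) (hε1 : ε ≤ 1)
    (ha : a ≠ ⊤) (hab : a ≤ b) (hb : b ≤ D * a) :
    b * (b ^ ε - a ^ ε) ≤ D * ENNReal.ofReal ε * (b ^ (1 + ε) - a ^ (1 + ε)) := by
  have hbt : b ≠ ⊤ := ne_top_of_le_ne_top (ENNReal.mul_ne_top coe_ne_top ha) hb
  lift a to ℝ≥0 using ha
  lift b to ℝ≥0 using hbt
  have hε' : 0 ≤ 1 + ε := by linarith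
  rw [ENNReal.ofReal]
  norm_cast at hab hb
  rcases eq_or_ne a 0 with rfl | ha0
  · have : b = 0 := le_antisymm (by simpa using hb) bot_le
    simp [this]
  have ha0' : 0 < (a : ℝ) := by positivity
  rw [← ENNReal.coe_rpow_of_nonneg _ hε, ← ENNReal.coe_rpow_of_nonneg _ hε,
    ← ENNReal.coe_rpow_of_nonneg _ hε', ← ENNReal.coe_rpow_of_nonneg _ hε']
  norm_cast
  rw [← NNReal.coe_le_coe]
  push_cast
  rw [NNReal.coe_sub (NNReal.rpow_le_rpow hab hε), NNReal.coe_sub (NNReal.rpow_le_rpow hab hε'),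
    Real.coe_toNNReal _ hε]
  push_cast
  have hab' : (a : ℝ) ≤ b := hab
  have hb' : (b : ℝ) ≤ D * a := hb
  generalize (a : ℝ) = a at *
  have hb0 : 0 ≤ (b : ℝ) := b.2
  have hD0 : 0 ≤ (D : ℝ) := D.2
  generalize (b : ℝ) = b at *
  generalize (D : ℝ) = D at *
  have hbpos : 0 < b := ha0'.trans_le hab'
  have h1 : b ^ ε ≤ a ^ ε * (1 + ε * (b / a - 1)) := by
    have h := rpow_one_add_le_one_add_mul_self (s := b / a - 1)
      (by have : 0 ≤ b / a := by positivity
          linarith) hε hε1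
    have e : b ^ ε = a ^ ε * (1 + (b / a - 1)) ^ ε := by
      rw [← Real.mul_rpow ha0'.le (by simp; positivity)]
      congr 1
      field_simp
      ring
    rw [e]
    gcongr
  have h2 : a ^ ε * (b - a) ≤ b ^ (1 + ε) - a ^ (1 + ε) := by
    rw [Real.rpow_add hbpos, Real.rpow_add ha0', Real.rpow_one, Real.rpow_one]
    have : a ^ ε ≤ b ^ ε := Real.rpow_le_rpow ha0'.le hab' hε
    nlinarith
  have haε : 0 < a ^ ε := by positivity
  calc b * (b ^ ε - a ^ ε) ≤ b * (a ^ ε * (ε * (b / a - 1))) := by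
        gcongr
        linarith
    _ = (b / a) * ε * (a ^ ε * (b - a)) := by field_simp
    _ ≤ D * ε * (a ^ ε * (b - a)) := by
        have : b / a ≤ D := (div_le_iff₀ ha0').2 hb'
        have : 0 ≤ b - a := by linarith
        gcongr
    _ ≤ _ := by gcongr

variable {μ : Measure X} {idx : ℕ → X → ι} {w F : X → ℝ≥0∞} {D : ℝ≥0} {L K : ℝ≥0∞} {ε : ℝ}

lemma fiberAvg_congr {idx : X → ι} {x y : X} (h : idx x = idx y) :
    fiberAvg μ idx w x = fiberAvg μ idx w y := by
  simp only [fiberAvg, h]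

omit [MeasurableSpace X] in
lemma index_eq_of_le (hnest : ∀ k x y, idx (k + 1) x = idx (k + 1) y → idx k x = idx k y)
    {j k : ℕ} (hjk : j ≤ k) {x y : X} (h : idx k x = idx k y) : idx j x = idx j y := by
  induction k, hjk using Nat.le_induction with
  | base => exact h
  | succ k _ ih => exact ih (hnest _ _ _ h)

lemma runMax_succ (N : ℕ) (x : X) :
    runMax μ idx w (N + 1) x = max (runMax μ idx w N x) (fiberAvg μ (idx (N + 1)) w x) :=
  partialSups_add_one _ _

lemma runMax_mono (x : X) : Monotone fun N => runMax μ idx w N x :=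
  (partialSups _).monotone

lemma fiberAvg_le_runMax {k N : ℕ} (h : k ≤ N) (x : X) :
    fiberAvg μ (idx k) w x ≤ runMax μ idx w N x :=
  le_partialSups_of_le (fun k => fiberAvg μ (idx k) w x) h

lemma runMax_le {N : ℕ} {x : X} {a : ℝ≥0∞} (h : ∀ k, k ≤ N → fiberAvg μ (idx k) w x ≤ a) :
    runMax μ idx w N x ≤ a :=
  partialSups_le _ _ _ h

lemma runMax_congr (hnest : ∀ k x y, idx (k + 1) x = idx (k + 1) y → idx k x = idx k y)
    {N : ℕ} {x y : X} (h : idx N x = idx N y) : runMax μ idx w N x = runMax μ idx w N y :=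
  le_antisymm
    (runMax_le fun _ hk => (fiberAvg_congr (index_eq_of_le hnest hk h)).trans_le
      (fiberAvg_le_runMax hk y))
    (runMax_le fun _ hk => (fiberAvg_congr (index_eq_of_le hnest hk h)).symm.trans_le
      (fiberAvg_le_runMax hk x))

lemma runMax_le_pow_mul (hD1 : 1 ≤ D)
    (hD : ∀ k x, fiberAvg μ (idx (k + 1)) w x ≤ D * fiberAvg μ (idx k) w x) (N : ℕ) (x : X) :
    runMax μ idx w N x ≤ (D : ℝ≥0∞) ^ N * fiberAvg μ (idx 0) w x := by
  have hf (k : ℕ) : fiberAvg μ (idx k) w x ≤ (D : ℝ≥0∞) ^ k * fiberAvg μ (idx 0) w x := by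
    induction k with
    | zero => simp
    | succ k ih =>
      refine (hD k x).trans ?_
      rw [pow_succ', mul_assoc]
      gcongr
  refine runMax_le fun k hk => (hf k).trans ?_
  gcongr
  exact_mod_cast hD1

variable [Countable ι] [MeasurableSpace ι] [MeasurableSingletonClass ι]

lemma measurable_fiberAvg {idx : X → ι} (h : Measurable idx) : Measurable (fiberAvg μ idx w) :=
  (measurable_of_countable fun i : ι => (μ (idx ⁻¹' {i}))⁻¹ * ∫⁻ y in idx ⁻¹' {i}, w y ∂μ).comp h

lemma measurable_runMax (hm : ∀ k, Measurable (idx k)) (N : ℕ) :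
    Measurable (runMax μ idx w N) := by
  induction N with
  | zero => exact measurable_fiberAvg (hm 0)
  | succ N ih =>
    simp only [funext (runMax_succ N)]
    exact ih.max (measurable_fiberAvg (hm _))

/-- A fibrewise inequality between integrals, tested against a function constant on fibres. -/
lemma lintegral_mul_le_of_fiber {idx : X → ι} (hm : Measurable idx) {G g : X → ℝ≥0∞}
    (hg : ∀ x y, idx x = idx y → g x = g y) (hgt : ∀ x, g x ≠ ⊤)
    (h : ∀ x, g x ≠ 0 →
      ∫⁻ y in idx ⁻¹' {idx x}, F y ∂μ ≤ ∫⁻ y in idx ⁻¹' {idx x}, G y ∂μ) :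
    ∫⁻ x, F x * g x ∂μ ≤ ∫⁻ x, G x * g x ∂μ := by
  have hU : (⋃ i : ι, idx ⁻¹' {i}) = Set.univ := by
    ext x
    simp
  have hms (i : ι) : MeasurableSet (idx ⁻¹' {i}) := hm (measurableSet_singleton i)
  have hdisj : Pairwise (Function.onFun Disjoint fun i : ι => idx ⁻¹' {i}) := fun i j hij =>
    Disjoint.preimage _ (by simpa using hij)
  rw [← setLIntegral_univ, ← hU, lintegral_iUnion hms hdisj, ← setLIntegral_univ (fun x => G x * g x),
    ← hU, lintegral_iUnion hms hdisj]
  refine ENNReal.tsum_le_tsum fun i => ?_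
  rcases (idx ⁻¹' {i}).eq_empty_or_nonempty with he | ⟨x, hx⟩
  · simp [he]
  have hx' : idx x = i := hx
  subst hx'
  have key (H : X → ℝ≥0∞) : ∫⁻ y in idx ⁻¹' {idx x}, H y * g y ∂μ
      = (∫⁻ y in idx ⁻¹' {idx x}, H y ∂μ) * g x := by
    rw [← lintegral_mul_const' _ _ (hgt x)]
    exact setLIntegral_congr_fun (hms _) fun y hy => by rw [hg y x hy]
  rw [key, key]
  rcases eq_or_ne (g x) 0 with h0 | h0
  · simp [h0]
  · exact mul_le_mul' (h x h0) le_rfl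

omit [Countable ι] in
lemma setLIntegral_fiberAvg [IsFiniteMeasure μ] {idx : X → ι} (hm : Measurable idx) {x : X}
    (hpos : μ (idx ⁻¹' {idx x}) ≠ 0) :
    ∫⁻ y in idx ⁻¹' {idx x}, fiberAvg μ idx w y ∂μ = ∫⁻ y in idx ⁻¹' {idx x}, w y ∂μ := by
  rw [setLIntegral_congr_fun (g := fun _ => fiberAvg μ idx w x) (hm (measurableSet_singleton _))
    fun y hy => fiberAvg_congr hy, setLIntegral_const, fiberAvg, mul_comm, ← mul_assoc,
    ENNReal.mul_inv_cancel hpos (measure_ne_top _ _), one_mul]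

lemma lintegral_mul_runMax_rpow_le [IsFiniteMeasure μ] (hm : ∀ k, Measurable (idx k))
    (hnest : ∀ k x y, idx (k + 1) x = idx (k + 1) y → idx k x = idx k y)
    (hpos : ∀ k x, μ (idx k ⁻¹' {idx k x}) ≠ 0) (hD1 : 1 ≤ D)
    (hD : ∀ k x, fiberAvg μ (idx (k + 1)) w x ≤ D * fiberAvg μ (idx k) w x)
    (hw : ∫⁻ x, w x ∂μ ≠ ⊤) (hε : 0 ≤ ε) (hε1 : ε ≤ 1) (hF : AEMeasurable F μ)
    (hL : L ≠ ⊤)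
    (h : ∀ k x, (∀ j ≤ k, fiberAvg μ (idx j) w x ≤ fiberAvg μ (idx k) w x) →
      ∫⁻ y in idx k ⁻¹' {idx k x}, F y ∂μ ≤ L * ∫⁻ y in idx k ⁻¹' {idx k x}, w y ∂μ) (N : ℕ) :
    ∫⁻ x, F x * runMax μ idx w N x ^ ε ∂μ ≤
      ∫⁻ x, F x * fiberAvg μ (idx 0) w x ^ ε ∂μ +
        L * (D * ENNReal.ofReal ε) * ∫⁻ x, runMax μ idx w N x ^ (1 + ε) ∂μ := by
  set M := runMax μ idx w with hM
  set f := fun k => fiberAvg μ (idx k) w with hf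
  have hMm (k : ℕ) : Measurable (M k) := measurable_runMax hm k
  have hMt (k : ℕ) (x : X) : M k x ≠ ⊤ := by
    refine ne_top_of_le_ne_top ?_ (runMax_le_pow_mul hD1 hD k x)
    refine ENNReal.mul_ne_top (by simp) (ENNReal.mul_ne_top (by simpa using hpos 0 x) ?_)
    exact ne_top_of_le_ne_top hw (setLIntegral_le_lintegral _ _)
  have hMmono (k : ℕ) (x : X) : M k x ≤ M (k + 1) x := runMax_mono x k.le_succ
  have hnew (k : ℕ) (x : X) (hne : M (k + 1) x ≠ M k x) : M (k + 1) x = f (k + 1) x := by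
    have := runMax_succ (μ := μ) (idx := idx) (w := w) k x
    rcases max_choice (M k x) (f (k + 1) x) with h' | h'
    · exact absurd (this.trans h') hne
    · exact this.trans h'
  set G := fun k x => M (k + 1) x ^ ε - M k x ^ ε with hG
  have hstep (k : ℕ) : ∫⁻ x, F x * G k x ∂μ ≤
      L * (D * ENNReal.ofReal ε) * ∫⁻ x, (M (k + 1) x ^ (1 + ε) - M k x ^ (1 + ε)) ∂μ := by
    have h1 : ∫⁻ x, F x * G k x ∂μ ≤ ∫⁻ x, (L * f (k + 1) x) * G k x ∂μ := by
      refine lintegral_mul_le_of_fiber (hm (k + 1)) (fun x y hxy => ?_) (fun x => ?_)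
        fun x hx => ?_
      · simp only [hG, hM]
        rw [runMax_congr hnest hxy, runMax_congr hnest (hnest _ _ _ hxy)]
      · exact ENNReal.sub_ne_top (ENNReal.rpow_ne_top_of_nonneg hε (hMt _ _))
      · have hne : M (k + 1) x ≠ M k x := fun h' => hx (by simp [hG, h'])
        rw [lintegral_const_mul' _ _ hL, setLIntegral_fiberAvg (hm (k + 1)) (hpos _ _)]
        refine h (k + 1) x fun j hj => ?_
        exact (fiberAvg_le_runMax hj x).trans_eq (hnew k x hne)
    refine h1.trans ?_
    simp only [mul_assoc L]
    rw [lintegral_const_mul' _ _ hL,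
      ← lintegral_const_mul' (D * ENNReal.ofReal ε) _ (by finiteness)]
    refine mul_le_mul' le_rfl (lintegral_mono fun x => ?_)
    rcases eq_or_ne (M (k + 1) x) (M k x) with heq | hne
    · simp [hG, heq]
    · simp only [hG]
      rw [← hnew k x hne]
      refine mul_rpow_sub_rpow_le hε hε1 (hMt k x) (hMmono k x) ?_
      rw [hnew k x hne]
      exact (hD k x).trans (by gcongr; exact fiberAvg_le_runMax le_rfl x)
  have hsum (a : ℝ) (ha : 0 ≤ a) (x : X) :
      M N x ^ a = M 0 x ^ a + ∑ k ∈ Finset.range N, (M (k + 1) x ^ a - M k x ^ a) := by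
    induction N with
    | zero => simp
    | succ N ih =>
      rw [Finset.sum_range_succ, ← add_assoc, ← ih,
        add_tsub_cancel_of_le (ENNReal.rpow_le_rpow (hMmono N x) ha)]
  have hGm (a : ℝ) (k : ℕ) : Measurable fun x => M (k + 1) x ^ a - M k x ^ a :=
    ((hMm _).pow_const _).sub ((hMm _).pow_const _)
  calc ∫⁻ x, F x * M N x ^ ε ∂μ
      = ∫⁻ x, F x * f 0 x ^ ε ∂μ + ∑ k ∈ Finset.range N, ∫⁻ x, F x * G k x ∂μ := by
        have hFG (k : ℕ) : AEMeasurable (fun x => F x * G k x) μ := hF.mul (hGm ε k).aemeasurable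
        have hFf : AEMeasurable (fun x => F x * f 0 x ^ ε) μ :=
          hF.mul ((hMm 0).pow_const ε).aemeasurable
        rw [← lintegral_finsetSum' _ fun k _ => hFG k, ← lintegral_add_left' hFf]
        refine lintegral_congr fun x => ?_
        rw [hsum ε hε x, mul_add, Finset.mul_sum]
        rfl
    _ ≤ ∫⁻ x, F x * f 0 x ^ ε ∂μ + ∑ k ∈ Finset.range N, L * (D * ENNReal.ofReal ε) *
          ∫⁻ x, (M (k + 1) x ^ (1 + ε) - M k x ^ (1 + ε)) ∂μ := by
        gcongr with k
        exact hstep k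
    _ ≤ _ := by
        rw [← Finset.mul_sum, ← lintegral_finsetSum' _ fun k _ => (hGm (1 + ε) k).aemeasurable]
        gcongr with x
        rw [hsum (1 + ε) (by linarith) x]
        exact le_add_self

/-- Reverse Hölder inequality along a regular sequence of nested partitions: if the running maxima
of averages satisfy a Fujii–Wilson bound on the stopped fibres, then a small power of the
running maximum can be absorbed. -/
lemma lintegral_self_mul_runMax_rpow_le [IsFiniteMeasure μ] (hm : ∀ k, Measurable (idx k))
    (hnest : ∀ k x y, idx (k + 1) x = idx (k + 1) y → idx k x = idx k y)
    (hpos : ∀ k x, μ (idx k ⁻¹' {idx k x}) ≠ 0) (hD1 : 1 ≤ D)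
    (hD : ∀ k x, fiberAvg μ (idx (k + 1)) w x ≤ D * fiberAvg μ (idx k) w x)
    (h0 : ∀ x y, idx 0 x = idx 0 y)
    (hwm : AEMeasurable w μ) (hw : ∫⁻ x, w x ∂μ ≠ ⊤) (hε : 0 ≤ ε) (hε1 : ε ≤ 1)
    (hK : K ≠ ⊤) (hKε : K * (D * ENNReal.ofReal ε) ≤ (2⁻¹ : ℝ≥0∞))
    (h : ∀ N k x, (∀ j ≤ k, fiberAvg μ (idx j) w x ≤ fiberAvg μ (idx k) w x) →
      ∫⁻ y in idx k ⁻¹' {idx k x}, runMax μ idx w N y ∂μ ≤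
        K * ∫⁻ y in idx k ⁻¹' {idx k x}, w y ∂μ) (N : ℕ) :
    ∫⁻ x, w x * runMax μ idx w N x ^ ε ∂μ ≤
      2 * ((μ Set.univ)⁻¹ * ∫⁻ x, w x ∂μ) ^ ε * ∫⁻ x, w x ∂μ := by
  rcases isEmpty_or_nonempty X with hX | ⟨⟨x₀⟩⟩
  · simp [lintegral_of_isEmpty]
  have huniv : idx 0 ⁻¹' {idx 0 x₀} = Set.univ := by
    ext y
    simpa using h0 y x₀
  have hf0 (x : X) : fiberAvg μ (idx 0) w x = (μ Set.univ)⁻¹ * ∫⁻ x, w x ∂μ := by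
    rw [fiberAvg_congr (h0 x x₀), fiberAvg, huniv, setLIntegral_univ]
  have hμ : μ Set.univ ≠ 0 := huniv ▸ hpos 0 x₀
  set A := (μ Set.univ)⁻¹ * ∫⁻ x, w x ∂μ with hA
  have hAt : A ≠ ⊤ := ENNReal.mul_ne_top (by simpa using hμ) hw
  have hAε : A ^ ε ≠ ⊤ := ENNReal.rpow_ne_top_of_nonneg hε hAt
  have h1 := lintegral_mul_runMax_rpow_le hm hnest hpos hD1 hD hw hε hε1
    (measurable_runMax hm N).aemeasurable hK (h N) N
  have h2 := lintegral_mul_runMax_rpow_le (L := 1) hm hnest hpos hD1 hD hw hε hε1 hwm one_ne_top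
    (fun k x _ => by simp) N
  simp only [hf0] at h1 h2
  rw [lintegral_mul_const' _ _ hAε] at h1 h2
  set I := ∫⁻ x, runMax μ idx w N x ^ (1 + ε) ∂μ with hI
  have e1 : ∫⁻ x, runMax μ idx w N x * runMax μ idx w N x ^ ε ∂μ = I := by
    refine lintegral_congr fun x => ?_
    rw [ENNReal.rpow_add_of_nonneg _ _ zero_le_one hε, ENNReal.rpow_one]
  have hIt : I ≠ ⊤ := by
    have hb : I ≤ ∫⁻ _, ((D : ℝ≥0∞) ^ N * A) ^ (1 + ε) ∂μ := by
      refine lintegral_mono fun x => ?_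
      refine ENNReal.rpow_le_rpow ?_ (by linarith)
      exact hf0 x ▸ runMax_le_pow_mul hD1 hD N x
    refine ne_top_of_le_ne_top ?_ hb
    rw [lintegral_const]
    refine ENNReal.mul_ne_top (ENNReal.rpow_ne_top_of_nonneg (by linarith) ?_) (measure_ne_top _ _)
    exact ENNReal.mul_ne_top (by simp) hAt
  have hM : ∫⁻ x, runMax μ idx w N x ∂μ ≤ K * ∫⁻ x, w x ∂μ := by
    have := h N 0 x₀ (fun j hj => by simp [Nat.le_zero.1 hj])
    rwa [huniv, setLIntegral_univ, setLIntegral_univ] at this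
  have h3 : I ≤ 2 * (K * (∫⁻ x, w x ∂μ) * A ^ ε) := by
    rw [e1] at h1
    have h4 : I ≤ K * (∫⁻ x, w x ∂μ) * A ^ ε + 2⁻¹ * I := h1.trans (by gcongr)
    have h5 : I - 2⁻¹ * I ≤ K * (∫⁻ x, w x ∂μ) * A ^ ε := tsub_le_iff_right.2 h4
    have h6 : I - 2⁻¹ * I = 2⁻¹ * I := by
      refine ENNReal.sub_eq_of_eq_add (by finiteness) ?_
      rw [← add_mul, ENNReal.inv_two_add_inv_two, one_mul]
    rw [h6] at h5
    calc I = 2 * (2⁻¹ * I) := by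
          rw [← mul_assoc, ENNReal.mul_inv_cancel (by simp) (by simp), one_mul]
      _ ≤ _ := by gcongr
  calc _ ≤ (∫⁻ x, w x ∂μ) * A ^ ε + D * ENNReal.ofReal ε * I := by simpa using h2
    _ ≤ (∫⁻ x, w x ∂μ) * A ^ ε +
        D * ENNReal.ofReal ε * (2 * (K * (∫⁻ x, w x ∂μ) * A ^ ε)) := by gcongr
    _ = (∫⁻ x, w x ∂μ) * A ^ ε +
        2 * (K * (D * ENNReal.ofReal ε)) * ((∫⁻ x, w x ∂μ) * A ^ ε) := by ring
    _ ≤ (∫⁻ x, w x ∂μ) * A ^ ε + 2 * 2⁻¹ * ((∫⁻ x, w x ∂μ) * A ^ ε) := by gcongr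
    _ = _ := by
      rw [ENNReal.mul_inv_cancel (by simp) (by simp)]
      ring

lemma lintegral_rpow_le_of_le_iSup_runMax [IsFiniteMeasure μ] (hm : ∀ k, Measurable (idx k))
    (hnest : ∀ k x y, idx (k + 1) x = idx (k + 1) y → idx k x = idx k y)
    (hpos : ∀ k x, μ (idx k ⁻¹' {idx k x}) ≠ 0) (hD1 : 1 ≤ D)
    (hD : ∀ k x, fiberAvg μ (idx (k + 1)) w x ≤ D * fiberAvg μ (idx k) w x)
    (h0 : ∀ x y, idx 0 x = idx 0 y)
    (hwm : AEMeasurable w μ) (hw : ∫⁻ x, w x ∂μ ≠ ⊤) (hε : 0 ≤ ε) (hε1 : ε ≤ 1)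
    (hK : K ≠ ⊤) (hKε : K * (D * ENNReal.ofReal ε) ≤ (2⁻¹ : ℝ≥0∞))
    (h : ∀ N k x, (∀ j ≤ k, fiberAvg μ (idx j) w x ≤ fiberAvg μ (idx k) w x) →
      ∫⁻ y in idx k ⁻¹' {idx k x}, runMax μ idx w N y ∂μ ≤
        K * ∫⁻ y in idx k ⁻¹' {idx k x}, w y ∂μ)
    (hsup : ∀ᵐ x ∂μ, w x ≤ ⨆ N, runMax μ idx w N x) :
    ∫⁻ x, w x ^ (1 + ε) ∂μ ≤ 2 * ((μ Set.univ)⁻¹ * ∫⁻ x, w x ∂μ) ^ ε * ∫⁻ x, w x ∂μ := by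
  have h1 : ∫⁻ x, w x ^ (1 + ε) ∂μ ≤ ∫⁻ x, ⨆ N, w x * runMax μ idx w N x ^ ε ∂μ := by
    refine lintegral_mono_ae ?_
    filter_upwards [hsup] with x hx
    rw [ENNReal.rpow_add_of_nonneg _ _ zero_le_one hε, ENNReal.rpow_one, ← ENNReal.mul_iSup]
    gcongr
    refine (ENNReal.rpow_le_rpow hx hε).trans_eq ?_
    exact (ENNReal.monotone_rpow_of_nonneg hε).map_ciSup_of_continuousAt
      ENNReal.continuous_rpow_const.continuousAt (OrderTop.bddAbove _)
  refine h1.trans ?_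
  have hwM (N : ℕ) : AEMeasurable (fun x => w x * runMax μ idx w N x ^ ε) μ :=
    hwm.mul ((measurable_runMax hm N).pow_const ε).aemeasurable
  rw [lintegral_iSup' hwM]
  · exact iSup_le fun N =>
      lintegral_self_mul_runMax_rpow_le hm hnest hpos hD1 hD h0 hwm hw hε hε1 hK hKε h N
  · refine Filter.Eventually.of_forall fun x N N' hN => ?_
    dsimp only
    gcongr
    exact runMax_mono x hN

end AtomAverages


section DyadicCubes

open scoped NNReal Topology

variable {d : ℕ}

namespace Cube

/-- The half-open cube with the same corner and side length. -/
def halfOpen (Q : Cube d) : Set (Rd d) :=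
  {x | ∀ i, Q.corner i ≤ x i ∧ x i < Q.corner i + Q.side}

lemma halfOpen_subset_set (Q : Cube d) : Q.halfOpen ⊆ Q.set :=
  fun _ hx i => ⟨(hx i).1, (hx i).2.le⟩

lemma isClosed_set (Q : Cube d) : IsClosed Q.set := by
  simp only [set, Set.ofPred_forall, Set.ofPred_and]
  refine isClosed_iInter fun i => ?_
  exact (isClosed_le (by fun_prop) (by fun_prop)).inter (isClosed_le (by fun_prop) (by fun_prop))

lemma measurableSet_halfOpen (Q : Cube d) : MeasurableSet Q.halfOpen := by
  simp only [halfOpen, Set.ofPred_forall, Set.ofPred_and]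
  refine MeasurableSet.iInter fun i => ?_
  exact (measurableSet_le (by fun_prop) (by fun_prop)).inter
    (measurableSet_lt (by fun_prop) (by fun_prop))

lemma volume_set (Q : Cube d) : volume Q.set = ENNReal.ofReal Q.side ^ d := by
  have h := (EuclideanSpace.volume_preserving_symm_measurableEquiv_toLp (Fin d)).measure_preimage
    (s := Set.Icc (fun i => Q.corner i) fun i => Q.corner i + Q.side)
    measurableSet_Icc.nullMeasurableSet
  rw [Real.volume_Icc_pi] at h
  simp only [add_sub_cancel_left, Finset.prod_const, Finset.card_univ, Fintype.card_fin] at h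
  rw [← h]
  congr 1
  ext x
  simp only [set, Set.mem_ofPred_eq, Set.mem_preimage, Set.mem_Icc, Pi.le_def, ← forall_and]
  rfl

lemma volume_halfOpen (Q : Cube d) : volume Q.halfOpen = ENNReal.ofReal Q.side ^ d := by
  have h := (EuclideanSpace.volume_preserving_symm_measurableEquiv_toLp (Fin d)).measure_preimage
    (s := Set.univ.pi fun i => Set.Ico (Q.corner i) (Q.corner i + Q.side))
    (MeasurableSet.univ_pi fun _ => measurableSet_Ico).nullMeasurableSet
  rw [Real.volume_pi_Ico] at h
  simp only [add_sub_cancel_left, Finset.prod_const, Finset.card_univ, Fintype.card_fin] at h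
  rw [← h]
  congr 1
  ext x
  simp only [halfOpen, Set.mem_ofPred_eq, Set.mem_preimage, Set.mem_univ_pi, Set.mem_Ico]
  rfl

lemma volume_set_ne_zero (Q : Cube d) : volume Q.set ≠ 0 := by
  rw [volume_set]
  exact pow_ne_zero _ (by simpa using Q.side_pos)

lemma volume_set_ne_top (Q : Cube d) : volume Q.set ≠ ⊤ := by
  rw [volume_set]
  finiteness

lemma halfOpen_ae_eq_set (Q : Cube d) : Q.halfOpen =ᵐ[volume] Q.set :=
  ae_eq_of_subset_of_measure_ge Q.halfOpen_subset_set (by rw [volume_set, volume_halfOpen])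
    Q.measurableSet_halfOpen.nullMeasurableSet Q.volume_set_ne_top

/-- The generation-`k` dyadic subcube of `Q` with integer coordinates `m`. -/
def dyadic (Q : Cube d) (k : ℕ) (m : Fin d → ℤ) : Cube d where
  corner := WithLp.toLp 2 fun i => Q.corner i + Q.side / 2 ^ k * m i
  side := Q.side / 2 ^ k
  side_pos := div_pos Q.side_pos (by positivity)

/-- The integer coordinates of the generation-`k` dyadic subcube of `Q` through a point. -/
def dyadicIndex (Q : Cube d) (k : ℕ) (x : Rd d) : Fin d → ℤ :=
  fun i => ⌊2 ^ k * (x i - Q.corner i) / Q.side⌋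

lemma dyadicIndex_eq_iff (Q : Cube d) (k : ℕ) (x : Rd d) (m : Fin d → ℤ) :
    Q.dyadicIndex k x = m ↔ x ∈ (Q.dyadic k m).halfOpen := by
  have hs := Q.side_pos
  simp only [funext_iff, dyadicIndex, Int.floor_eq_iff, halfOpen, dyadic, Set.mem_ofPred_eq]
  refine forall_congr' fun i => and_congr ?_ ?_
  · rw [le_div_iff₀ hs, ← le_sub_iff_add_le', div_mul_eq_mul_div, div_le_iff₀ (by positivity)]
    ring_nf
  · rw [div_lt_iff₀ hs, add_assoc, ← sub_lt_iff_lt_add', ← mul_add_one, div_mul_eq_mul_div,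
      lt_div_iff₀ (by positivity)]
    ring_nf

lemma dyadicIndex_eq_of_succ (Q : Cube d) (k : ℕ) (x y : Rd d)
    (h : Q.dyadicIndex (k + 1) x = Q.dyadicIndex (k + 1) y) :
    Q.dyadicIndex k x = Q.dyadicIndex k y := by
  have key (z : Rd d) (i : Fin d) : Q.dyadicIndex k z i = Q.dyadicIndex (k + 1) z i / 2 := by
    have := Int.floor_div_natCast (2 ^ (k + 1) * (z i - Q.corner i) / Q.side) 2
    simp only [dyadicIndex]
    rw [← Nat.cast_ofNat (R := ℤ), ← this]
    congr 1
    push_cast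
    ring
  funext i
  rw [key, key, h]

lemma dyadicIndex_zero_eq_iff (Q : Cube d) (x : Rd d) :
    Q.dyadicIndex 0 x = 0 ↔ x ∈ Q.halfOpen := by
  rw [dyadicIndex_eq_iff]
  simp [halfOpen, dyadic]

lemma measurable_dyadicIndex (Q : Cube d) (k : ℕ) : Measurable (Q.dyadicIndex k) := by
  refine measurable_pi_lambda _ fun i => Int.measurable_floor.comp ?_
  fun_prop

lemma dyadicIndex_eq_of_le (Q : Cube d) {j k : ℕ} (hjk : j ≤ k) {x y : Rd d}
    (h : Q.dyadicIndex k x = Q.dyadicIndex k y) : Q.dyadicIndex j x = Q.dyadicIndex j y :=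
  index_eq_of_le (idx := Q.dyadicIndex) Q.dyadicIndex_eq_of_succ hjk h

/-- The generation-`k` dyadic subcube of `Q` through `x`. -/
def dyadicAt (Q : Cube d) (k : ℕ) (x : Rd d) : Cube d :=
  Q.dyadic k (Q.dyadicIndex k x)

lemma mem_halfOpen_dyadicAt_iff {Q : Cube d} {k : ℕ} {x y : Rd d} :
    y ∈ (Q.dyadicAt k x).halfOpen ↔ Q.dyadicIndex k y = Q.dyadicIndex k x :=
  (Q.dyadicIndex_eq_iff k y _).symm

lemma halfOpen_dyadicAt_subset {Q : Cube d} {j k : ℕ} (hjk : j ≤ k) (x : Rd d) :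
    (Q.dyadicAt k x).halfOpen ⊆ (Q.dyadicAt j x).halfOpen := fun _ hy =>
  mem_halfOpen_dyadicAt_iff.2 (Q.dyadicIndex_eq_of_le hjk (mem_halfOpen_dyadicAt_iff.1 hy))

lemma halfOpen_dyadicAt_subset_halfOpen {Q : Cube d} (k : ℕ) {x : Rd d} (hx : x ∈ Q.halfOpen) :
    (Q.dyadicAt k x).halfOpen ⊆ Q.halfOpen := by
  intro y hy
  rw [← dyadicIndex_zero_eq_iff] at hx ⊢
  rw [← hx]
  exact Q.dyadicIndex_eq_of_le k.zero_le (mem_halfOpen_dyadicAt_iff.1 hy)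

lemma subset_closedBall (Q : Cube d) {x : Rd d} (hx : x ∈ Q.set) :
    Q.set ⊆ Metric.closedBall x (√d * Q.side) := by
  intro y hy
  rw [Metric.mem_closedBall, EuclideanSpace.dist_eq]
  have hs := Q.side_pos.le
  calc √(∑ i, dist (y i) (x i) ^ 2) ≤ √(∑ _i : Fin d, Q.side ^ 2) := by
        gcongr with i
        rw [Real.dist_eq, abs_le]
        constructor <;> linarith [hx i, hy i, (hx i).1, (hx i).2, (hy i).1, (hy i).2]
    _ = √d * Q.side := by
        simp [Real.sqrt_sq hs]

lemma nonempty_interior_set (Q : Cube d) : (interior Q.set).Nonempty := by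
  have hs := Q.side_pos
  have ho : IsOpen {x : Rd d | ∀ i, Q.corner i < x i ∧ x i < Q.corner i + Q.side} := by
    simp only [Set.ofPred_forall, Set.ofPred_and]
    refine isOpen_iInter_of_finite fun i => ?_
    exact (isOpen_lt (by fun_prop) (by fun_prop)).inter (isOpen_lt (by fun_prop) (by fun_prop))
  have hsub : {x : Rd d | ∀ i, Q.corner i < x i ∧ x i < Q.corner i + Q.side} ⊆ Q.set :=
    fun x hx i => ⟨(hx i).1.le, (hx i).2.le⟩
  refine ⟨WithLp.toLp 2 fun i => Q.corner i + Q.side / 2, interior_maximal hsub ho fun i => ?_⟩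
  constructor <;> simp <;> linarith

/-- Lebesgue differentiation along the dyadic subcubes of a cube. -/
lemma ae_tendsto_dyadicAt (Q : Cube d) {f : Rd d → ℝ≥0∞} (hf : AEMeasurable f)
    (hft : ∫⁻ x, f x ≠ ⊤) :
    ∀ᵐ x, Filter.Tendsto (fun k => (∫⁻ y in (Q.dyadicAt k x).set, f y) /
      volume (Q.dyadicAt k x).set) Filter.atTop (𝓝 (f x)) := by
  set B : ℝ≥0∞ := volume (Metric.ball (0 : Rd d) 1) with hB
  have hBt : B ≠ ⊤ := measure_ball_lt_top.ne
  obtain ⟨C, hC⟩ : ∃ C : ℝ≥0, (C : ℝ≥0∞) =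
      ENNReal.ofReal (3 ^ d) + ENNReal.ofReal ((3 * √d) ^ d) * B :=
    ⟨_, ENNReal.coe_toNNReal (by finiteness)⟩
  have hdoub (x : Rd d) : ∃ᶠ r in 𝓝[>] (0 : ℝ), volume (Metric.closedBall x (3 * r)) ≤
      C * volume (Metric.closedBall x r) := by
    refine Filter.Eventually.frequently ?_
    filter_upwards [self_mem_nhdsWithin] with r hr
    have hr' : 0 ≤ r := le_of_lt hr
    rw [Measure.addHaar_closedBall _ _ hr', Measure.addHaar_closedBall _ _ (by positivity),
      ← mul_assoc, finrank_euclideanSpace_fin, mul_pow, ENNReal.ofReal_mul (by positivity)]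
    gcongr
    rw [hC]
    exact le_self_add
  filter_upwards [(Vitali.vitaliFamily volume C hdoub).ae_tendsto_lintegral_div hf hft] with x hx
  refine hx.comp ((VitaliFamily.tendsto_filterAt_iff _).2 ⟨?_, fun ε hε => ?_⟩)
  · refine Filter.Eventually.of_forall fun k => ?_
    have hxm : x ∈ (Q.dyadicAt k x).set :=
      halfOpen_subset_set _ (mem_halfOpen_dyadicAt_iff.2 rfl)
    have hs := (Q.dyadicAt k x).side_pos.le
    refine ⟨isClosed_set _, nonempty_interior_set _, _, subset_closedBall _ hxm, ?_⟩
    rw [Measure.addHaar_closedBall _ _ (by positivity), finrank_euclideanSpace_fin, volume_set,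
      ← mul_assoc, mul_pow, ENNReal.ofReal_mul (by positivity), ENNReal.ofReal_pow hs, mul_right_comm]
    gcongr
    rw [hC]
    exact le_add_self
  · have hlim : Filter.Tendsto (fun k : ℕ => √d * (Q.side / 2 ^ k)) Filter.atTop (𝓝 0) := by
      have := (tendsto_pow_atTop_nhds_zero_of_lt_one (r := (2 : ℝ)⁻¹) (by norm_num)
        (by norm_num)).const_mul (√d * Q.side)
      rw [mul_zero] at this
      refine this.congr fun k => ?_
      rw [inv_pow]
      ring
    filter_upwards [hlim.eventually_le_const hε] with k hk
    have hxm : x ∈ (Q.dyadicAt k x).set :=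
      halfOpen_subset_set _ (mem_halfOpen_dyadicAt_iff.2 rfl)
    exact (subset_closedBall _ hxm).trans (Metric.closedBall_subset_closedBall hk)

end Cube

end DyadicCubes

section ScalarReverseHolder

open scoped NNReal Topology

variable {d : ℕ} {w : Rd d → ℝ≥0∞} {K : ℝ≥0∞}

lemma laverage_le_HLM {S R : Cube d} (hSR : S.halfOpen ⊆ R.set) {y : Rd d} (hy : y ∈ S.set) :
    (volume S.set)⁻¹ * ∫⁻ z in S.set, w z ≤ HLM (R.set.indicator w) y := by
  have e : ∫⁻ z in S.set, w z = ∫⁻ z in S.set, R.set.indicator w z := by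
    rw [← setLIntegral_congr S.halfOpen_ae_eq_set, ← setLIntegral_congr S.halfOpen_ae_eq_set]
    exact setLIntegral_congr_fun S.measurableSet_halfOpen fun z hz =>
      (Set.indicator_of_mem (hSR hz) w).symm
  rw [e]
  exact le_iSup₂ (f := fun (Q : Cube d) (_ : y ∈ Q.set) =>
    (volume Q.set)⁻¹ * ∫⁻ z in Q.set, R.set.indicator w z) S hy

lemma lintegral_HLM_le (hA : AInftyConst w ≤ K) (R : Cube d) (hR : ∫⁻ x in R.set, w x ≠ ⊤) :
    ∫⁻ x in R.set, HLM (R.set.indicator w) x ≤ K * ∫⁻ x in R.set, w x := by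
  have h : (∫⁻ x in R.set, w x)⁻¹ * ∫⁻ x in R.set, HLM (R.set.indicator w) x ≤ K :=
    (le_iSup (fun R : Cube d =>
      (∫⁻ x in R.set, w x)⁻¹ * ∫⁻ x in R.set, HLM (R.set.indicator w) x) R).trans hA
  rcases eq_or_ne (∫⁻ x in R.set, w x) 0 with h0 | h0
  · have hz (x : Rd d) : HLM (R.set.indicator w) x = 0 := by
      simp only [HLM, ENNReal.iSup_eq_zero, mul_eq_zero]
      refine fun Q _ => Or.inr (le_antisymm ?_ bot_le)
      calc ∫⁻ y in Q.set, R.set.indicator w y ≤ ∫⁻ y, R.set.indicator w y :=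
            setLIntegral_le_lintegral _ _
        _ = 0 := by rw [lintegral_indicator R.isClosed_set.measurableSet, h0]
    simp [hz]
  · rwa [mul_comm, ← div_eq_mul_inv, ENNReal.div_le_iff h0 hR] at h

lemma one_le_of_AInftyConst_le (hA : AInftyConst w ≤ K) (R : Cube d)
    (hR : ∫⁻ x in R.set, w x ≠ ⊤) (hR0 : ∫⁻ x in R.set, w x ≠ 0) :
    1 ≤ K := by
  have h := lintegral_HLM_le hA R hR
  have h2 : ∫⁻ x in R.set, w x ≤ ∫⁻ x in R.set, HLM (R.set.indicator w) x := by
    calc ∫⁻ x in R.set, w x = ∫⁻ _ in R.set, (volume R.set)⁻¹ * ∫⁻ z in R.set, w z := by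
          rw [setLIntegral_const, mul_right_comm,
            ENNReal.inv_mul_cancel R.volume_set_ne_zero R.volume_set_ne_top, one_mul]
      _ ≤ _ := setLIntegral_mono_ae' R.isClosed_set.measurableSet
          (Filter.Eventually.of_forall fun x hx => laverage_le_HLM R.halfOpen_subset_set hx)
  have h3 : 1 * ∫⁻ x in R.set, w x ≤ K * ∫⁻ x in R.set, w x := by
    rw [one_mul]
    exact h2.trans h
  exact (ENNReal.mul_le_mul_iff_left hR0 hR).1 h3

lemma laverage_dyadicAt_succ_le (Q : Cube d) (k : ℕ) (x : Rd d) :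
    (volume (Q.dyadicAt (k + 1) x).set)⁻¹ * ∫⁻ y in (Q.dyadicAt (k + 1) x).set, w y ≤
      ((2 ^ d : ℝ≥0) : ℝ≥0∞) *
        ((volume (Q.dyadicAt k x).set)⁻¹ * ∫⁻ y in (Q.dyadicAt k x).set, w y) := by
  have hside : volume (Q.dyadicAt k x).set = 2 ^ d * volume (Q.dyadicAt (k + 1) x).set := by
    rw [Cube.volume_set, Cube.volume_set, ← mul_pow, ← ENNReal.ofReal_ofNat,
      ← ENNReal.ofReal_mul (by norm_num)]
    congr 2
    simp only [Cube.dyadicAt, Cube.dyadic]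
    field_simp
    ring
  rw [hside, ← mul_assoc, ENNReal.mul_inv (by simp) (by simp), ← mul_assoc]
  push_cast
  rw [ENNReal.mul_inv_cancel (by simp) (by simp), one_mul]
  gcongr _ * ?_
  rw [← setLIntegral_congr (Cube.halfOpen_ae_eq_set _),
    ← setLIntegral_congr (Q.dyadicAt k x).halfOpen_ae_eq_set]
  exact lintegral_mono_set (Cube.halfOpen_dyadicAt_subset k.le_succ x)

lemma laverage_rpow_le_of_small (hwm : AEMeasurable w) (hK : K ≠ ⊤) (hA : AInftyConst w ≤ K)
    (Q : Cube d) (hQ : ∫⁻ x in Q.set, w x ≠ ⊤) {ε : ℝ} (hε : 0 ≤ ε) (hε1 : ε ≤ 1)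
    (hKε : K * (2 ^ d * ENNReal.ofReal ε) ≤ (2⁻¹ : ℝ≥0∞)) :
    (volume Q.set)⁻¹ * ∫⁻ x in Q.set, w x ^ (1 + ε) ≤
      2 * ((volume Q.set)⁻¹ * ∫⁻ x in Q.set, w x) ^ (1 + ε) := by
  have hms := Q.measurableSet_halfOpen
  set μ : Measure Q.halfOpen := volume.comap Subtype.val with hμ
  have hmap : μ.map Subtype.val = volume.restrict Q.halfOpen := map_comap_subtype_coe hms _
  set idx : ℕ → Q.halfOpen → (Fin d → ℤ) := fun k x => Q.dyadicIndex k x with hidx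
  set v : Q.halfOpen → ℝ≥0∞ := fun x => w x with hv
  have htot (g : Rd d → ℝ≥0∞) : ∫⁻ x : Q.halfOpen, g x ∂μ = ∫⁻ x in Q.set, g x := by
    rw [lintegral_subtype_comap hms, setLIntegral_congr Q.halfOpen_ae_eq_set]
  have huniv : μ Set.univ = volume Q.set := by
    rw [hμ, comap_subtype_coe_apply hms, Set.image_univ, Subtype.range_coe,
      measure_congr Q.halfOpen_ae_eq_set]
  have : IsFiniteMeasure μ := ⟨by rw [huniv]; exact Q.volume_set_ne_top.lt_top⟩
  have himg (k : ℕ) (x : Q.halfOpen) :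
      Subtype.val '' (idx k ⁻¹' {idx k x}) = (Q.dyadicAt k x).halfOpen := by
    ext y
    simp only [Set.mem_image, Set.mem_preimage, Set.mem_singleton_iff, hidx,
      Cube.mem_halfOpen_dyadicAt_iff]
    constructor
    · rintro ⟨z, hz, rfl⟩
      exact hz
    · intro hy
      exact ⟨⟨y, Cube.halfOpen_dyadicAt_subset_halfOpen k x.2
        (Cube.mem_halfOpen_dyadicAt_iff.2 hy)⟩, hy, rfl⟩
  have hvol (k : ℕ) (x : Q.halfOpen) :
      μ (idx k ⁻¹' {idx k x}) = volume (Q.dyadicAt k x).set := by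
    rw [hμ, comap_subtype_coe_apply hms, himg, measure_congr (Cube.halfOpen_ae_eq_set _)]
  have hfib (k : ℕ) (x : Q.halfOpen) (g : Rd d → ℝ≥0∞) :
      ∫⁻ y in idx k ⁻¹' {idx k x}, g y ∂μ = ∫⁻ y in (Q.dyadicAt k x).set, g y := by
    rw [hμ, setLIntegral_subtype hms, himg, setLIntegral_congr (Cube.halfOpen_ae_eq_set _)]
  have havg (k : ℕ) (x : Q.halfOpen) : fiberAvg μ (idx k) v x =
      (volume (Q.dyadicAt k x).set)⁻¹ * ∫⁻ y in (Q.dyadicAt k x).set, w y := by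
    rw [fiberAvg, hvol, hfib k x w]
  have hsubQ (k : ℕ) (x : Q.halfOpen) : (Q.dyadicAt k x).halfOpen ⊆ Q.set :=
    (Cube.halfOpen_dyadicAt_subset_halfOpen k x.2).trans Q.halfOpen_subset_set
  have hmem (k : ℕ) (x : Rd d) : x ∈ (Q.dyadicAt k x).set :=
    Cube.halfOpen_subset_set _ (Cube.mem_halfOpen_dyadicAt_iff.2 rfl)
  have hm (k : ℕ) : Measurable (idx k) := (Q.measurable_dyadicIndex k).comp measurable_subtype_coe
  have hnest (k : ℕ) (x y : Q.halfOpen) (h : idx (k + 1) x = idx (k + 1) y) : idx k x = idx k y :=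
    Q.dyadicIndex_eq_of_succ k x y h
  have hQ' : ∫⁻ x, Q.set.indicator w x ≠ ⊤ := by
    rwa [lintegral_indicator Q.isClosed_set.measurableSet]
  have hvm : AEMeasurable v μ := by
    have : AEMeasurable w (μ.map Subtype.val) := by
      rw [hmap]
      exact hwm.restrict
    exact this.comp_measurable measurable_subtype_coe
  have hsup : ∀ᵐ x ∂μ, v x ≤ ⨆ N, runMax μ idx v N x := by
    have h := ae_restrict_of_ae (s := Q.halfOpen)
      (Q.ae_tendsto_dyadicAt (hwm.indicator Q.isClosed_set.measurableSet) hQ')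
    rw [← hmap] at h
    filter_upwards [ae_of_ae_map measurable_subtype_coe.aemeasurable h] with x hx
    rw [Set.indicator_of_mem (Q.halfOpen_subset_set x.2)] at hx
    refine le_of_tendsto hx (Filter.Eventually.of_forall fun k => ?_)
    refine le_trans (le_of_eq ?_) ((fiberAvg_le_runMax le_rfl x).trans
      (le_iSup (fun N => runMax μ idx v N x) k))
    rw [havg, ENNReal.div_eq_inv_mul, ← setLIntegral_congr (Cube.halfOpen_ae_eq_set _),
      ← setLIntegral_congr (Cube.halfOpen_ae_eq_set _)]
    congr 1
    exact setLIntegral_congr_fun (Cube.measurableSet_halfOpen _) fun z hz =>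
      Set.indicator_of_mem (hsubQ k x hz) w
  have key := lintegral_rpow_le_of_le_iSup_runMax (μ := μ) (idx := idx) (w := v) (K := K)
    (D := 2 ^ d) (ε := ε) hm hnest (fun k x => by rw [hvol]; exact Cube.volume_set_ne_zero _)
    (one_le_pow₀ one_le_two) (fun k x => by
      rw [havg, havg]
      exact laverage_dyadicAt_succ_le Q k x)
    (fun x y => ((Q.dyadicIndex_zero_eq_iff x).2 x.2).trans
      ((Q.dyadicIndex_zero_eq_iff y).2 y.2).symm) hvm (by rwa [htot w]) hε hε1 hK
    (by push_cast; exact hKε) (fun N k x hx => by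
      set R := Q.dyadicAt k x with hR
      have hRt : ∫⁻ y in R.set, w y ≠ ⊤ := by
        refine ne_top_of_le_ne_top hQ ?_
        rw [← setLIntegral_congr R.halfOpen_ae_eq_set]
        exact lintegral_mono_set (hsubQ k x)
      rw [hfib k x w]
      refine le_trans ?_ (lintegral_HLM_le hA R hRt)
      rw [← hfib k x]
      refine setLIntegral_mono_ae' (hm k (measurableSet_singleton _))
        (Filter.Eventually.of_forall fun y hy => runMax_le fun j _ => ?_)
      have hyR : (y : Rd d) ∈ R.halfOpen := Cube.mem_halfOpen_dyadicAt_iff.2 hy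
      rcases le_total j k with hjk | hkj
      · rw [fiberAvg_congr (index_eq_of_le hnest hjk hy)]
        refine (hx j hjk).trans ?_
        rw [havg]
        exact laverage_le_HLM R.halfOpen_subset_set (R.halfOpen_subset_set hyR)
      · rw [havg]
        refine laverage_le_HLM ?_ (hmem j y)
        have e : Q.dyadicAt k y = R := by
          simp only [hR, Cube.dyadicAt]
          rw [show Q.dyadicIndex k y = Q.dyadicIndex k x from hy]
        exact e ▸ (Cube.halfOpen_dyadicAt_subset hkj (y : Rd d)).trans
          (Cube.halfOpen_subset_set _)) hsup
  rw [huniv, htot w, htot fun x => w x ^ (1 + ε)] at key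
  calc _ ≤ (volume Q.set)⁻¹ * (2 * ((volume Q.set)⁻¹ * ∫⁻ x in Q.set, w x) ^ ε *
        ∫⁻ x in Q.set, w x) := by gcongr
    _ = 2 * (((volume Q.set)⁻¹ * ∫⁻ x in Q.set, w x) *
        ((volume Q.set)⁻¹ * ∫⁻ x in Q.set, w x) ^ ε) := by ring
    _ = _ := by rw [ENNReal.rpow_add_of_nonneg _ _ zero_le_one hε, ENNReal.rpow_one]

/-- The sharp reverse Hölder inequality for scalar weights with finite Fujii–Wilson constant. -/
lemma laverage_rpow_le_of_AInftyConst_le (hwm : AEMeasurable w) (hK : K ≠ ⊤)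
    (hA : AInftyConst w ≤ K) (Q : Cube d) {ε : ℝ} (hε : ε = ((2 : ℝ) ^ (d + 11) * K.toReal)⁻¹) :
    (volume Q.set)⁻¹ * ∫⁻ x in Q.set, w x ^ (1 + ε) ≤
      2 * ((volume Q.set)⁻¹ * ∫⁻ x in Q.set, w x) ^ (1 + ε) := by
  have hε0 : 0 ≤ ε := hε ▸ by positivity
  rcases eq_or_ne (∫⁻ x in Q.set, w x) ⊤ with ht | ht
  · rw [ht, ENNReal.mul_top (by simpa using Q.volume_set_ne_top),
      ENNReal.top_rpow_of_pos (by linarith), ENNReal.mul_top (by simp)]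
    exact le_top
  rcases eq_or_ne (∫⁻ x in Q.set, w x) 0 with h0 | h0
  · have hz : ∀ᵐ x ∂volume.restrict Q.set, w x ^ (1 + ε) = 0 := by
      filter_upwards [(lintegral_eq_zero_iff' hwm.restrict).1 h0] with x hx
      rw [hx, Pi.zero_apply, ENNReal.zero_rpow_of_pos (by linarith)]
    rw [lintegral_congr_ae hz]
    simp
  have hK1 := one_le_of_AInftyConst_le hA Q ht h0
  have hKr : 1 ≤ K.toReal := by
    rw [← ENNReal.toReal_one]
    exact ENNReal.toReal_mono hK hK1
  have hpow : (1 : ℝ) ≤ 2 ^ (d + 11) := one_le_pow₀ one_le_two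
  refine laverage_rpow_le_of_small hwm hK hA Q ht hε0 ?_ ?_
  · rw [hε]
    exact inv_le_one_of_one_le₀ (one_le_mul_of_one_le_of_one_le hpow hKr)
  · have e : K * (2 ^ d * ENNReal.ofReal ε) = ENNReal.ofReal (K.toReal * (2 ^ d * ε)) := by
      rw [ENNReal.ofReal_mul (by positivity), ENNReal.ofReal_mul (by positivity),
        ENNReal.ofReal_toReal hK, ENNReal.ofReal_pow (by norm_num), ENNReal.ofReal_ofNat]
    have e2 : (2⁻¹ : ℝ≥0∞) = ENNReal.ofReal 2⁻¹ := by
      rw [ENNReal.ofReal_inv_of_pos (by norm_num), ENNReal.ofReal_ofNat]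
    rw [e, e2]
    apply ENNReal.ofReal_le_ofReal
    have : K.toReal * (2 ^ d * ε) = (2 ^ 11)⁻¹ := by
      rw [hε, pow_add]
      field_simp
    rw [this]
    norm_num

end ScalarReverseHolder

section MatrixReverseHolder

open scoped NNReal

variable {n d : ℕ}

lemma opNorm_mul_le_sum {A B : Mat n} :
    opNorm (A * B) ≤ ∑ i, ‖mvec A (mvec B (EuclideanSpace.single i 1))‖ := by
  simpa only [mvec_mul] using opNorm_le_sum_basis (A * B)

lemma norm_mvec_mvec_single_le (A B : Mat n) (i : Fin n) :
    ‖mvec A (mvec B (EuclideanSpace.single i 1))‖ ≤ opNorm (A * B) := by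
  rw [← mvec_mul]
  simpa using norm_mvec_le (A * B) (EuclideanSpace.single i 1)

lemma laverage_opNorm_rpow_le {W : Rd d → Mat n} (hW : IsMatrixWeight W) {p q r : ℝ} (hn : 1 ≤ n)
    (hq : 1 ≤ q) (hqp : q < p) (hr : 1 ≤ r) {Q : Cube d}
    (hRH : ∀ e : Vec n, (volume Q.set)⁻¹ *
      ∫⁻ x in Q.set, ((‖mvec (matPow (W x) (1/q)) e‖₊ : ℝ≥0∞) ^ q) ^ r ≤
        2 * ((volume Q.set)⁻¹ *
          ∫⁻ x in Q.set, (‖mvec (matPow (W x) (1/q)) e‖₊ : ℝ≥0∞) ^ q) ^ r)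
    {V : Mat n} (hV : V.PosDef) :
    (volume Q.set)⁻¹ * ∫⁻ x in Q.set,
        ENNReal.ofReal (opNorm (matPow (W x) (1/p) * matPow V (-(1/p)))) ^ (r * p) ≤
      (n : ℝ≥0∞) ^ (r * q) * (2 * n) * ((volume Q.set)⁻¹ * ∫⁻ x in Q.set,
        ENNReal.ofReal (opNorm (matPow (W x) (1/q) * matPow V (-(1/q)))) ^ q) ^ r := by
  have hq0 : 0 < q := by linarith
  have hp0 : 0 < p := by linarith
  have hr0 : 0 < r := by linarith
  set e : Fin n → Vec n := fun i => mvec (matPow V (-(1/q))) (EuclideanSpace.single i 1) with he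
  set a : Fin n → Rd d → ℝ≥0∞ := fun i x => (‖mvec (matPow (W x) (1/q)) (e i)‖₊ : ℝ≥0∞) with ha
  set S := (volume Q.set)⁻¹ * ∫⁻ x in Q.set,
    ENNReal.ofReal (opNorm (matPow (W x) (1/q) * matPow V (-(1/q)))) ^ q with hS
  have hpt : ∀ᵐ x ∂volume.restrict Q.set,
      ENNReal.ofReal (opNorm (matPow (W x) (1/p) * matPow V (-(1/p)))) ^ (r * p) ≤
        (n : ℝ≥0∞) ^ (r * q) * ∑ i, (a i x ^ q) ^ r := by
    filter_upwards [ae_restrict_of_ae hW.2] with x hx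
    set T := opNorm (matPow (W x) (1/q) * matPow V (-(1/q))) with hT
    have hT0 : 0 ≤ T := norm_nonneg _
    have h1 : opNorm (matPow (W x) (1/p) * matPow V (-(1/p))) ≤ T ^ (q / p) := by
      have := opNorm_matPow_mul_le hx hV (s := 1 / p) (t := 1 / q) (by positivity)
        (one_div_le_one_div_of_le hq0 hqp.le)
      rwa [show 1 / p / (1 / q) = q / p by field_simp] at this
    have h2 : ENNReal.ofReal T ≤ n * ⨆ i, a i x := by
      calc ENNReal.ofReal T ≤ ∑ i, a i x := by
            refine (ENNReal.ofReal_le_ofReal opNorm_mul_le_sum).trans_eq ?_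
            rw [ENNReal.ofReal_sum_of_nonneg fun _ _ => norm_nonneg _]
            exact Finset.sum_congr rfl fun i _ => ofReal_norm _
        _ ≤ ∑ _i : Fin n, ⨆ i, a i x := Finset.sum_le_sum fun i _ => le_iSup (fun i => a i x) i
        _ = _ := by simp
    have : Nonempty (Fin n) := ⟨⟨0, hn⟩⟩
    obtain ⟨i₀, hi₀⟩ := exists_eq_ciSup_of_finite (f := fun i => a i x)
    calc ENNReal.ofReal (opNorm (matPow (W x) (1/p) * matPow V (-(1/p)))) ^ (r * p)
        ≤ (ENNReal.ofReal T ^ (q / p)) ^ (r * p) := by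
          rw [ENNReal.ofReal_rpow_of_nonneg hT0 (by positivity)]
          gcongr
      _ = ENNReal.ofReal T ^ (r * q) := by
          rw [← ENNReal.rpow_mul]
          congr 1
          field_simp
      _ ≤ (n * a i₀ x) ^ (r * q) := by
          rw [← hi₀] at h2
          gcongr
      _ = (n : ℝ≥0∞) ^ (r * q) * (a i₀ x ^ q) ^ r := by
          rw [ENNReal.mul_rpow_of_nonneg _ _ (by positivity), ← ENNReal.rpow_mul, mul_comm q r]
      _ ≤ _ := by
          gcongr
          exact Finset.single_le_sum (f := fun i => (a i x ^ q) ^ r) (fun _ _ => bot_le)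
            (Finset.mem_univ i₀)
  have ham (i : Fin n) : AEMeasurable (fun x => (a i x ^ q) ^ r) (volume.restrict Q.set) :=
    (((aemeasurable_norm_mvec_matPow hW (1/q) (e i)).coe_nnreal_ennreal.pow_const q).pow_const
      r).restrict
  have haS (i : Fin n) : (volume Q.set)⁻¹ * ∫⁻ x in Q.set, a i x ^ q ≤ S := by
    refine mul_le_mul' le_rfl (lintegral_mono fun x => ?_)
    refine ENNReal.rpow_le_rpow ?_ hq0.le
    rw [ha]
    refine (ofReal_norm _).symm.trans_le (ENNReal.ofReal_le_ofReal ?_)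
    exact norm_mvec_mvec_single_le _ _ i
  calc _ ≤ (volume Q.set)⁻¹ * ∫⁻ x in Q.set, (n : ℝ≥0∞) ^ (r * q) * ∑ i, (a i x ^ q) ^ r :=
        mul_le_mul' le_rfl (lintegral_mono_ae hpt)
    _ = (n : ℝ≥0∞) ^ (r * q) * ∑ i, (volume Q.set)⁻¹ * ∫⁻ x in Q.set, (a i x ^ q) ^ r := by
        rw [lintegral_const_mul' _ _
          (ENNReal.rpow_ne_top_of_nonneg (by positivity) (natCast_ne_top n)),
          lintegral_finsetSum' _ fun i _ => ham i, mul_left_comm, Finset.mul_sum]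
    _ ≤ (n : ℝ≥0∞) ^ (r * q) * ∑ _i : Fin n, 2 * S ^ r := by
        refine mul_le_mul' le_rfl (Finset.sum_le_sum fun i _ => ?_)
        exact (hRH (e i)).trans (mul_le_mul' le_rfl (ENNReal.rpow_le_rpow (haS i) hr0.le))
    _ = _ := by
        rw [Finset.sum_const, Finset.card_univ, Fintype.card_fin, nsmul_eq_mul]
        ring

end MatrixReverseHolder

/-- Key reverse Hölder lemma: with `r = 1 + 1/(2^{d+11} [W]_{A^{sc}_{q,∞}})`, the
`L^{rp}`-average of `‖W^{1/p}(x)W^{-1/p}(y)‖` over a cube is controlled by the `q`-average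
of `‖W^{1/q}(x)W^{-1/q}(y)‖` to the power `1/p`, for a.e. `y` in the cube. -/
theorem key_reverse_holder (n : ℕ) (hn : 1 ≤ n) (p q : ℝ) (hq : 1 ≤ q) (hqp : q < p) :
    ∃ c : ℝ≥0∞, 0 < c ∧ c ≠ ⊤ ∧
      ∀ (d : ℕ), 1 ≤ d → ∀ W : Rd d → Mat n, IsMatrixWeight W →
        (q = 1 → A1Const W ≠ ⊤) → (1 < q → AqConst W q ≠ ⊤) → AqScConst W q ≠ ⊤ →
        ∀ Q : Cube d,
          ∀ᵐ y ∂volume.restrict Q.set,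
            ((volume Q.set)⁻¹ * ∫⁻ x in Q.set,
                ENNReal.ofReal (opNorm (matPow (W x) (1/p) * matPow (W y) (-(1/p)))) ^
                  ((1 + ((2:ℝ) ^ (d + 11) * (AqScConst W q).toReal)⁻¹) * p)) ^
              (1 / ((1 + ((2:ℝ) ^ (d + 11) * (AqScConst W q).toReal)⁻¹) * p)) ≤
            c * ((volume Q.set)⁻¹ * ∫⁻ x in Q.set,
                ENNReal.ofReal (opNorm (matPow (W x) (1/q) * matPow (W y) (-(1/q)))) ^ q) ^
              (1/p) := by
  have hq0 : 0 < q := by linarith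
  have hp0 : 0 < p := by linarith
  have hnt : (n : ℝ≥0∞) ≠ ⊤ := natCast_ne_top n
  have hn0 : (n : ℝ≥0∞) ≠ 0 := by exact_mod_cast (by lia : n ≠ 0)
  have hn1 : (1 : ℝ≥0∞) ≤ 2 * n := by exact_mod_cast (by lia : 1 ≤ 2 * n)
  refine ⟨(n : ℝ≥0∞) ^ (q / p) * (2 * n),
    pos_iff_ne_zero.2 (mul_ne_zero (by simp [ENNReal.rpow_eq_zero_iff, hn0, hnt])
      (mul_ne_zero (by simp) hn0)),
    ENNReal.mul_ne_top (ENNReal.rpow_ne_top_of_nonneg (by positivity) hnt) (by finiteness), ?_⟩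
  intro d _ W hW _ _ hsc Q
  obtain ⟨ε, hε⟩ : ∃ ε : ℝ, ε = ((2 : ℝ) ^ (d + 11) * (AqScConst W q).toReal)⁻¹ := ⟨_, rfl⟩
  have hε0 : 0 ≤ ε := hε ▸ by positivity
  have hRH (e : Vec n) := laverage_rpow_le_of_AInftyConst_le
    ((aemeasurable_norm_mvec_matPow hW (1/q) e).coe_nnreal_ennreal.pow_const q) hsc
    (le_iSup (fun e : Vec n =>
      AInftyConst fun x => (‖mvec (matPow (W x) (1/q)) e‖₊ : ℝ≥0∞) ^ q) e) Q hε
  rw [← hε]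
  filter_upwards [ae_restrict_of_ae hW.2] with y hy
  set r := 1 + ε with hr
  have hr1 : 1 ≤ r := by linarith
  have hr0 : 0 < r := by linarith
  have hrp : 1 ≤ r * p := by nlinarith
  have hc : (2 * n : ℝ≥0∞) ^ (1 / (r * p)) ≤ 2 * n :=
    (ENNReal.rpow_le_rpow_of_exponent_le hn1 (by
      rw [div_le_one (by positivity)]
      exact hrp)).trans_eq (ENNReal.rpow_one _)
  refine (ENNReal.rpow_le_rpow
    (laverage_opNorm_rpow_le hW hn hq hqp hr1 hRH hy) (by positivity)).trans ?_
  rw [ENNReal.mul_rpow_of_nonneg _ _ (by positivity),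
    ENNReal.mul_rpow_of_nonneg _ _ (by positivity), ← ENNReal.rpow_mul, ← ENNReal.rpow_mul,
    show r * q * (1 / (r * p)) = q / p by field_simp, show r * (1 / (r * p)) = 1 / p by field_simp]
  gcongr

end
end

section
/- Let d, n ≥ 1, 1 < q < p < ∞, and let W be a matrix A_q weight on ℝ^d. Then there is a constant c depending only on n and q such that for every cube Q: [ (1/|Q|)∫_Q ( (1/|Q|)∫_Q ‖W(x)^{1/q} W(y)^{−1/q}‖^{q} dx )^{q'/p} dy ]^{1/q'} ≤ c · [W]_{A_q}^{1/p}, where q' = q/(q−1). -/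
open MeasureTheory ENNReal
open scoped ComplexOrder

noncomputable section

open scoped Matrix.Norms.L2Operator in
theorem continuousOn_matPow {n : ℕ} (s : ℝ) :
    ContinuousOn (fun A : Mat n => matPow A s) {A | A.PosDef} := by
  have h1 : ContinuousOn (fun A : Mat n => cfc (fun t : ℝ => t ^ s) A) {A | A.PosDef} := by
    refine ContinuousOn.cfc_of_mem_nhdsSet (A := Mat n) (s := Set.Ioi 0) _ ?_ continuousOn_id ?_ ?_
    · rw [isOpen_Ioi.mem_nhdsSet]
      simp only [Set.iUnion_subset_iff]
      intro A hA t ht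
      have hA' : A.PosDef := hA
      obtain ⟨i, rfl⟩ : ∃ i, hA'.isHermitian.eigenvalues i = t := by
        simpa [hA'.isHermitian.spectrum_real_eq_range_eigenvalues] using ht
      exact hA'.eigenvalues_pos i
    · intro A hA
      exact Matrix.PosDef.isHermitian hA
    · intro t ht
      exact (Real.continuousAt_rpow_const _ _ (Or.inl (ne_of_gt ht))).continuousWithinAt
  refine h1.congr fun A hA => ?_
  have hA' : A.IsHermitian := Matrix.PosDef.isHermitian hA
  simp only [matPow, hA', dif_pos, hA'.cfc_eq, Matrix.IsHermitian.cfc]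
  rfl

theorem isHermitian_matPow {n : ℕ} {A : Mat n} (hA : A.IsHermitian) (s : ℝ) :
    (matPow A s).IsHermitian := by
  simp only [matPow, hA, dif_pos, Matrix.star_eq_conjTranspose]
  refine Matrix.isHermitian_mul_mul_conjTranspose _ ?_
  rw [Matrix.isHermitian_diagonal_iff]
  intro i
  simp [isSelfAdjoint_iff]

theorem matPow_mul_matPow_neg {n : ℕ} {A : Mat n} (hA : A.PosDef) (s : ℝ) :
    matPow A s * matPow A (-s) = 1 := by
  have h := hA.isHermitian
  have hU : star (h.eigenvectorUnitary : Mat n) * (h.eigenvectorUnitary : Mat n) = 1 :=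
    Unitary.coe_star_mul_self _
  have hU' : (h.eigenvectorUnitary : Mat n) * star (h.eigenvectorUnitary : Mat n) = 1 :=
    Unitary.coe_mul_star_self _
  simp only [matPow, h, dif_pos]
  rw [← Matrix.mul_assoc, ← Matrix.mul_assoc, Matrix.mul_assoc _ (star _), hU, Matrix.mul_one,
    Matrix.mul_assoc _ (Matrix.diagonal _), Matrix.mul_assoc _ (Matrix.diagonal _),
    ← Matrix.mul_assoc (Matrix.diagonal _), Matrix.diagonal_mul_diagonal]
  have : (fun i => ((h.eigenvalues i ^ s : ℝ) : ℂ) * ((h.eigenvalues i ^ (-s) : ℝ) : ℂ)) =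
      fun _ => 1 := by
    funext i
    rw [← Complex.ofReal_mul, ← Real.rpow_add (hA.eigenvalues_pos i)]
    simp
  rw [this, Matrix.diagonal_one, Matrix.one_mul, hU']

theorem IsMatrixWeight.aemeasurable_matPow_apply {d n : ℕ} {W : Rd d → Mat n}
    (hW : IsMatrixWeight W) (s : ℝ) (v : Vec n) :
    AEMeasurable (fun x => Matrix.toEuclideanCLM (𝕜 := ℂ) (n := Fin n) (matPow (W x) s) v)
      volume := by
  classical
  borelize (Mat n)
  have hcont : Continuous fun A : {A : Mat n // A.PosDef} =>
      Matrix.toEuclideanCLM (𝕜 := ℂ) (n := Fin n) (matPow A.1 s) v := by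
    have h := (continuousOn_matPow (n := n) s).domRestrict
    refine (PiLp.continuous_toLp 2 _).comp (f := fun A : {A : Mat n // A.PosDef} =>
      (matPow A.1 s).mulVec v.ofLp) ?_
    exact Continuous.matrix_mulVec h continuous_const
  have hWm : Measurable W := by
    have : @Measurable _ _ _ MeasurableSpace.pi W :=
      measurable_pi_iff.2 fun i => measurable_pi_iff.2 fun j => hW.1 i j
    have hb : BorelSpace (Fin n → Fin n → ℂ) := inferInstance
    have e := hb.measurable_eq
    intro t ht
    apply this
    rw [e]
    exact ht
  obtain ⟨t, hts, htm, ht0⟩ := exists_measurable_superset_of_null (ae_iff.1 hW.2)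
  let g : Rd d → {A : Mat n // A.PosDef} := fun x =>
    if h : x ∈ t then ⟨1, Matrix.PosDef.one⟩ else ⟨W x, by by_contra hc; exact h (hts hc)⟩
  have hg : Measurable g := by
    have hg' : Measurable fun x => if x ∈ t then 1 else W x :=
      Measurable.ite htm measurable_const hWm
    have hgg : (fun x => if x ∈ t then 1 else W x) = fun x => (g x).1 := by
      funext x
      by_cases hx : x ∈ t <;> simp [g, hx]
    rw [hgg] at hg'
    exact hg'.subtype_mk
  refine ⟨_, hcont.measurable.comp hg, ?_⟩
  filter_upwards [measure_eq_zero_iff_ae_notMem.1 ht0] with x hx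
  simp [g, hx]


/-- An Auerbach-type basis: the columns of `V` lie in the unit ball of `σ` and nearly maximize
the determinant, so the coordinates given by `U` are controlled by `σ`. -/
theorem exists_adapted_basis {n : ℕ} (σ : Vec n → ℝ) (hσ : ∀ (c : ℂ) v, σ (c • v) = ‖c‖ * σ v)
    {δ : ℝ} (hδ : 0 < δ) (hle : ∀ v, δ * ‖v‖ ≤ σ v) :
    ∃ V U : Vec n →L[ℂ] Vec n, V * U = 1 ∧ (∀ i, σ (V (EuclideanSpace.single i 1)) ≤ 1) ∧
      ∀ v, ‖U v‖ ≤ 2 * n * σ v := by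
  have hσ0 : ∀ v, 0 ≤ σ v := fun v => (by positivity : 0 ≤ δ * ‖v‖).trans (hle v)
  have hpos : ∀ v, v ≠ 0 → 0 < σ v := fun v hv =>
    (mul_pos hδ (norm_pos_iff.2 hv)).trans_le (hle v)
  let P : Set (Mat n) := {A | ∀ i, σ (WithLp.toLp 2 (A.col i)) ≤ 1}
  let S : Set ℝ := (fun A : Mat n => ‖A.det‖) '' P
  have hbdd : BddAbove S := by
    refine ⟨(Fintype.card (Fin n)).factorial • (1 / δ) ^ Fintype.card (Fin n), ?_⟩
    rintro _ ⟨A, hA, rfl⟩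
    refine Matrix.det_le (abv := NormedField.toAbsoluteValue ℂ) fun j i => ?_
    have h1 := (hle _).trans (hA i)
    have h2 := PiLp.norm_apply_le (p := 2) (WithLp.toLp 2 (A.col i)) j
    rw [le_div_iff₀' hδ]
    exact (mul_le_mul_of_nonneg_left h2 hδ.le).trans h1
  have hS : ∃ s ∈ S, 0 < s := by
    have hs : ∀ i : Fin n, 0 < σ (EuclideanSpace.single i 1) := fun i => hpos _ (by simp)
    refine ⟨_, ⟨Matrix.diagonal fun i => (((σ (EuclideanSpace.single i 1))⁻¹ : ℝ) : ℂ), ?_,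
      rfl⟩, ?_⟩
    · intro i
      have : (WithLp.toLp 2 ((Matrix.diagonal fun i =>
          (((σ (EuclideanSpace.single i 1))⁻¹ : ℝ) : ℂ)).col i) : Vec n) =
          (((σ (EuclideanSpace.single i 1))⁻¹ : ℝ) : ℂ) • EuclideanSpace.single i (1 : ℂ) := by
        ext j
        by_cases hj : j = i
        · subst hj; simp
        · simp [hj]
      rw [this, hσ, Complex.norm_real, Real.norm_of_nonneg (inv_nonneg.2 (hs i).le),
        inv_mul_cancel₀ (hs i).ne']
    · simp only [Matrix.det_diagonal, norm_pos_iff]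
      exact Finset.prod_ne_zero_iff.2 fun i _ => by
        exact_mod_cast inv_ne_zero (hs i).ne'
  obtain ⟨s, hsS, hs⟩ := hS
  have hD : 0 < sSup S := hs.trans_le (le_csSup hbdd hsS)
  obtain ⟨_, ⟨A, hA, rfl⟩, hlt⟩ := exists_lt_of_lt_csSup ⟨s, hsS⟩ (half_lt_self hD)
  simp only at hlt
  have hdet : 0 < ‖A.det‖ := (half_pos hD).trans hlt
  have hunit : IsUnit A.det := (norm_pos_iff.1 hdet).isUnit
  refine ⟨Matrix.toEuclideanCLM (𝕜 := ℂ) (n := Fin n) A,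
    Matrix.toEuclideanCLM (𝕜 := ℂ) (n := Fin n) A⁻¹, ?_, ?_, ?_⟩
  · rw [← map_mul, Matrix.mul_nonsing_inv _ hunit, map_one]
  · intro i
    convert! hA i using 2
    rw [EuclideanSpace.single, Matrix.toEuclideanCLM_toLp]
    simp
  · intro v
    rcases eq_or_ne v 0 with rfl | hv
    · simpa using mul_nonneg (by positivity) (hσ0 0)
    have hsv := hpos v hv
    have hcoord : ∀ i, ‖(Matrix.toEuclideanCLM (𝕜 := ℂ) (n := Fin n) A⁻¹ v) i‖ ≤ 2 * σ v := by
      intro i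
      have h1 : A.det * (Matrix.toEuclideanCLM (𝕜 := ℂ) (n := Fin n) A⁻¹ v) i =
          (A.updateCol i v.ofLp).det := by
        rw [← Matrix.cramer_apply, ← Matrix.det_smul_inv_mulVec_eq_cramer _ _ hunit]
        rfl
      have h2 : A.updateCol i ((((σ v)⁻¹ : ℝ) : ℂ) • v.ofLp) ∈ P := by
        intro j
        by_cases hj : j = i
        · subst hj
          have : (WithLp.toLp 2 ((A.updateCol j ((((σ v)⁻¹ : ℝ) : ℂ) • v.ofLp)).col j) : Vec n) =
              (((σ v)⁻¹ : ℝ) : ℂ) • v := by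
            ext k; simp
          rw [this, hσ, Complex.norm_real, Real.norm_of_nonneg (inv_nonneg.2 hsv.le),
            inv_mul_cancel₀ hsv.ne']
        · have : (A.updateCol i ((((σ v)⁻¹ : ℝ) : ℂ) • v.ofLp)).col j = A.col j := by
            ext k; simp [hj]
          rw [this]
          exact hA j
      have h3 := le_csSup hbdd ⟨_, h2, rfl⟩
      simp only [Matrix.det_updateCol_smul, norm_mul, Complex.norm_real,
        Real.norm_of_nonneg (inv_nonneg.2 hsv.le), ← h1] at h3
      rw [inv_mul_le_iff₀ hsv] at h3
      have h4 : ‖A.det‖ * ‖(Matrix.toEuclideanCLM (𝕜 := ℂ) (n := Fin n) A⁻¹ v) i‖ ≤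
          ‖A.det‖ * (2 * σ v) := by nlinarith
      exact le_of_mul_le_mul_left h4 hdet
    generalize Matrix.toEuclideanCLM (𝕜 := ℂ) (n := Fin n) A⁻¹ v = w at hcoord
    rw [← (EuclideanSpace.basisFun (Fin n) ℂ).sum_repr w]
    refine (norm_sum_le _ _).trans ((Finset.sum_le_sum fun i _ =>
      (?_ : _ ≤ 2 * σ v)).trans (le_of_eq ?_))
    · simpa [norm_smul] using hcoord i
    · simp; ring

theorem enorm_le_sum_enorm_single {n : ℕ} (T : Vec n →L[ℂ] Vec n) :
    ‖T‖ₑ ≤ ∑ i, ‖T (EuclideanSpace.single i 1)‖ₑ := by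
  have h : ‖T‖ ≤ ∑ i, ‖T (EuclideanSpace.single i 1)‖ := by
    refine T.opNorm_le_bound (Finset.sum_nonneg fun i _ => norm_nonneg _) fun v => ?_
    conv_lhs => rw [← (EuclideanSpace.basisFun (Fin n) ℂ).sum_repr v]
    rw [map_sum, Finset.sum_mul]
    refine (norm_sum_le _ _).trans (Finset.sum_le_sum fun i _ => ?_)
    rw [map_smul, norm_smul, mul_comm]
    simpa using mul_le_mul_of_nonneg_left (PiLp.norm_apply_le (p := 2) v i) (norm_nonneg _)
  simp only [← ofReal_norm]
  rw [← ENNReal.ofReal_sum_of_nonneg fun i _ => norm_nonneg _]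
  exact ENNReal.ofReal_le_ofReal h

theorem Cube.set_eq_preimage_Icc {d : ℕ} (Q : Cube d) :
    Q.set = (MeasurableEquiv.toLp 2 (Fin d → ℝ)).symm ⁻¹'
      Set.Icc Q.corner.ofLp (fun i => Q.corner i + Q.side) := by
  ext x
  simp [Cube.set, Set.mem_Icc, Pi.le_def, forall_and]

theorem Cube.volume_set_s18 {d : ℕ} (Q : Cube d) : volume Q.set = ENNReal.ofReal Q.side ^ d := by
  rw [Q.set_eq_preimage_Icc,
    (EuclideanSpace.volume_preserving_symm_measurableEquiv_toLp (Fin d)).measure_preimage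
      measurableSet_Icc.nullMeasurableSet, Real.volume_Icc_pi]
  simp

theorem Cube.isProbabilityMeasure {d : ℕ} (Q : Cube d) :
    IsProbabilityMeasure ((volume Q.set)⁻¹ • volume.restrict Q.set) := by
  have h := Q.side_pos
  refine ⟨?_⟩
  simp only [Measure.smul_apply, Measure.restrict_apply_univ, smul_eq_mul]
  refine ENNReal.inv_mul_cancel ?_ ?_ <;> rw [Q.volume_set_s18]
  · exact pow_ne_zero _ (by simpa using h)
  · exact ENNReal.pow_ne_top ENNReal.ofReal_ne_top

section MixedAverage

variable {Ω : Type*} [MeasurableSpace Ω] {μ : Measure Ω} {n : ℕ}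
  {M N : Ω → Vec n →L[ℂ] Vec n} {r : ℝ}

theorem enorm_mul_comm_of_isSelfAdjoint {A B : Vec n →L[ℂ] Vec n} (hA : IsSelfAdjoint A)
    (hB : IsSelfAdjoint B) : ‖A * B‖ₑ = ‖B * A‖ₑ := by
  rw [← ofReal_norm, ← ofReal_norm, ← norm_star (A * B), star_mul, hA.star_eq, hB.star_eq]

theorem lintegral_enorm_apply_rpow_le (hr : 0 ≤ r) (hMs : ∀ᵐ x ∂μ, IsSelfAdjoint (M x))
    {A : Vec n →L[ℂ] Vec n} (hA : IsSelfAdjoint A) (v : Vec n) :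
    ∫⁻ y, ‖M y (A v)‖ₑ ^ r ∂μ ≤ ‖v‖ₑ ^ r * ∫⁻ y, ‖A * M y‖ₑ ^ r ∂μ := by
  rw [← lintegral_const_mul' _ _ (ENNReal.rpow_ne_top_of_nonneg hr enorm_ne_top)]
  refine lintegral_mono_ae ?_
  filter_upwards [hMs] with y hy
  rw [enorm_mul_comm_of_isSelfAdjoint hA hy, ← ENNReal.mul_rpow_of_nonneg _ _ hr, mul_comm]
  exact ENNReal.rpow_le_rpow ((M y * A).le_opENorm v) hr

theorem exists_rpow_mul_le_lintegral [IsProbabilityMeasure μ] (hr : 0 < r)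
    (hM : ∀ v, AEMeasurable (fun x => M x v) μ)
    (hMN : ∀ᵐ x ∂μ, M x * N x = 1) :
    ∃ δ : ℝ≥0∞, 0 < δ ∧ δ ≠ ⊤ ∧ ∀ v, δ * ‖v‖ₑ ^ r ≤ ∫⁻ y, ‖N y v‖ₑ ^ r ∂μ := by
  let H : Ω → ℝ≥0∞ := fun y => ∑ i, ‖M y (EuclideanSpace.single i 1)‖ₑ
  have hH : AEMeasurable H μ := Finset.aemeasurable_fun_sum _ fun i _ => (hM _).enorm
  have hHtop : ∀ y, H y ≠ ⊤ := fun y => ENNReal.sum_ne_top.2 fun i _ => enorm_ne_top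
  have hpos : ∀ y, 0 < (H y)⁻¹ ^ r := fun y =>
    ENNReal.rpow_pos_of_nonneg (ENNReal.inv_pos.2 (hHtop y)) hr.le
  refine ⟨min (∫⁻ y, (H y)⁻¹ ^ r ∂μ) 1, lt_min ?_ one_pos, ?_, fun v => ?_⟩
  · rw [pos_iff_ne_zero]
    intro h0
    rw [lintegral_eq_zero_iff' (show AEMeasurable (fun y => (H y)⁻¹ ^ r) μ from
      hH.inv.pow_const r)] at h0
    obtain ⟨y, hy⟩ := h0.exists
    exact (hpos y).ne' hy
  · exact ne_top_of_le_ne_top one_ne_top (min_le_right _ _)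
  · refine (mul_le_mul_left (min_le_left _ _) _).trans ?_
    rw [mul_comm, ← lintegral_const_mul' _ _ (ENNReal.rpow_ne_top_of_nonneg hr.le enorm_ne_top)]
    refine lintegral_mono_ae ?_
    filter_upwards [hMN] with y hy
    rw [← ENNReal.mul_rpow_of_nonneg _ _ hr.le]
    refine ENNReal.rpow_le_rpow ?_ hr.le
    rw [← div_eq_mul_inv]
    refine ENNReal.div_le_of_le_mul ?_
    calc ‖v‖ₑ = ‖M y (N y v)‖ₑ := by
          rw [← mul_apply_eq_comp, hy, one_apply_eq_self]
      _ ≤ ‖M y‖ₑ * ‖N y v‖ₑ := (M y).le_opENorm _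
      _ ≤ ‖N y v‖ₑ * H y := by
          rw [mul_comm]
          exact mul_le_mul_right (enorm_le_sum_enorm_single _) _

theorem lintegral_rpow_le_rpow_lintegral [IsProbabilityMeasure μ] {f : Ω → ℝ≥0∞}
    (hf : AEMeasurable f μ) {s : ℝ}
    (hs : 0 < s) (hsr : s ≤ r) : ∫⁻ y, f y ^ s ∂μ ≤ (∫⁻ y, f y ^ r ∂μ) ^ (s / r) := by
  have h := eLpNorm'_le_eLpNorm'_of_exponent_le hs hsr μ hf.aestronglyMeasurable
  simp only [eLpNorm', enorm_eq_self] at h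
  have h' := ENNReal.rpow_le_rpow h hs.le
  rwa [← ENNReal.rpow_mul, ← ENNReal.rpow_mul, one_div_mul_cancel hs.ne', ENNReal.rpow_one,
    one_div_mul_eq_div] at h'

/-- A pair of mutually inverse matrices adapted to the average `v ↦ ∫⁻ ‖N y v‖ₑ ^ r`. -/
theorem exists_reducing_pair [IsProbabilityMeasure μ] (hr : 0 < r)
    (hM : ∀ v, AEMeasurable (fun x => M x v) μ)
    (hMN : ∀ᵐ x ∂μ, M x * N x = 1) (hfin : ∀ v, ∫⁻ y, ‖N y v‖ₑ ^ r ∂μ ≠ ⊤) :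
    ∃ V U : Vec n →L[ℂ] Vec n, V * U = 1 ∧
      (∀ i, ∫⁻ y, ‖N y (V (EuclideanSpace.single i 1))‖ₑ ^ r ∂μ ≤ 1) ∧
      ∀ v, ‖U v‖ₑ ≤ 2 * n * (∫⁻ y, ‖N y v‖ₑ ^ r ∂μ) ^ (1 / r) := by
  have hr' : 0 ≤ 1 / r := by positivity
  let τ : Vec n → ℝ≥0∞ := fun v => (∫⁻ y, ‖N y v‖ₑ ^ r ∂μ) ^ (1 / r)
  have hτ : ∀ v, τ v ≠ ⊤ := fun v => ENNReal.rpow_ne_top_of_nonneg hr' (hfin v)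
  obtain ⟨δ, hδ, hδt, hle⟩ := exists_rpow_mul_le_lintegral (μ := μ) hr hM hMN
  have hhom : ∀ (c : ℂ) v, τ (c • v) = ‖c‖ₑ * τ v := by
    intro c v
    simp only [τ, map_smul, enorm_smul, ENNReal.mul_rpow_of_nonneg _ _ hr.le]
    rw [lintegral_const_mul' _ _ (ENNReal.rpow_ne_top_of_nonneg hr.le enorm_ne_top),
      ENNReal.mul_rpow_of_nonneg _ _ hr', ← ENNReal.rpow_mul, mul_one_div_cancel hr.ne',
      ENNReal.rpow_one]
  have hlow : ∀ v, δ ^ (1 / r) * ‖v‖ₑ ≤ τ v := by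
    intro v
    have h := ENNReal.rpow_le_rpow (hle v) hr'
    rwa [ENNReal.mul_rpow_of_nonneg _ _ hr', ← ENNReal.rpow_mul, mul_one_div_cancel hr.ne',
      ENNReal.rpow_one] at h
  have hδ' : δ ^ (1 / r) ≠ ⊤ := ENNReal.rpow_ne_top_of_nonneg hr' hδt
  obtain ⟨V, U, hVU, hV, hU⟩ := exists_adapted_basis (fun v => (τ v).toReal)
    (fun c v => by rw [hhom, ENNReal.toReal_mul, toReal_enorm])
    (ENNReal.toReal_pos (ENNReal.rpow_pos hδ hδt).ne' hδ')
    (fun v => by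
      rw [← toReal_enorm, ← ENNReal.toReal_mul]
      exact ENNReal.toReal_mono (hτ v) (hlow v))
  refine ⟨V, U, hVU, fun i => ?_, fun v => ?_⟩
  · have h : τ (V (EuclideanSpace.single i 1)) ≤ 1 := by
      rw [← ENNReal.ofReal_toReal (hτ _)]
      exact ENNReal.ofReal_le_one.2 (hV i)
    have h' := ENNReal.rpow_le_rpow h hr.le
    rwa [← ENNReal.rpow_mul, one_div_mul_cancel hr.ne', ENNReal.rpow_one,
      ENNReal.one_rpow] at h'
  · have h := ENNReal.ofReal_le_ofReal (hU v)
    rw [ofReal_norm, ENNReal.ofReal_mul (by positivity), ENNReal.ofReal_mul (by positivity),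
      ENNReal.ofReal_toReal (hτ v)] at h
    simpa [τ] using h

theorem mixed_average_le [IsProbabilityMeasure μ] (hn : 1 ≤ n)
    {p q : ℝ} (hq : 1 < q) (hp : q < p)
    (hM : ∀ v, AEMeasurable (fun x => M x v) μ) (hN : ∀ v, AEMeasurable (fun x => N x v) μ)
    (hMs : ∀ᵐ x ∂μ, IsSelfAdjoint (M x)) (hNs : ∀ᵐ x ∂μ, IsSelfAdjoint (N x))
    (hMN : ∀ᵐ x ∂μ, M x * N x = 1)
    (hT : ∫⁻ x, (∫⁻ y, ‖M x * N y‖ₑ ^ (q / (q - 1)) ∂μ) ^ (q - 1) ∂μ ≠ ⊤) :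
    (∫⁻ y, (∫⁻ x, ‖M x * N y‖ₑ ^ q ∂μ) ^ ((q / (q - 1)) / p) ∂μ) ^ ((q - 1) / q) ≤
      2 * n ^ 2 * (∫⁻ x, (∫⁻ y, ‖M x * N y‖ₑ ^ (q / (q - 1)) ∂μ) ^ (q - 1) ∂μ) ^ (1 / p) := by
  have hq0 : 0 < q := by linarith
  have hq1 : 0 < q - 1 := by linarith
  have hp0 : 0 < p := by linarith
  obtain ⟨r, hrq⟩ : ∃ r, r = q / (q - 1) := ⟨_, rfl⟩
  have hr1 : 1 < r := by rw [hrq, lt_div_iff₀ hq1]; linarith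
  have hr0 : 0 < r := by linarith
  have hqr : q / r = q - 1 := by rw [hrq]; field_simp
  have hrinv : (q - 1) / q = 1 / r := by rw [hrq]; field_simp
  rw [← hrq] at hT ⊢
  rw [hrinv]
  let I : Ω → ℝ≥0∞ := fun x => ∫⁻ y, ‖M x * N y‖ₑ ^ r ∂μ
  set T := ∫⁻ x, (∫⁻ y, ‖M x * N y‖ₑ ^ r ∂μ) ^ (q - 1) ∂μ with hTdef
  have hfin : ∀ v, ∫⁻ y, ‖N y v‖ₑ ^ r ∂μ ≠ ⊤ := by
    intro v
    obtain ⟨x, hxs, hxs', hx, hxI⟩ : ∃ x, IsSelfAdjoint (M x) ∧ IsSelfAdjoint (N x) ∧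
        M x * N x = 1 ∧ I x ≠ ⊤ := by
      by_contra! hcon
      refine hT ?_
      have : ∀ᵐ x ∂μ, (∫⁻ y, ‖M x * N y‖ₑ ^ r ∂μ) ^ (q - 1) = ⊤ := by
        filter_upwards [hMs, hNs, hMN] with x h1 h2 h3
        have h4 : ∫⁻ y, ‖M x * N y‖ₑ ^ r ∂μ = ⊤ := hcon x h1 h2 h3
        rw [h4, ENNReal.top_rpow_of_pos hq1]
      rw [hTdef, lintegral_congr_ae this]
      simp
    have h := lintegral_enorm_apply_rpow_le (μ := μ) hr0.le hNs hxs (N x v)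
    rw [← mul_apply_eq_comp, hx, one_apply_eq_self] at h
    exact ne_top_of_le_ne_top (ENNReal.mul_ne_top
      (ENNReal.rpow_ne_top_of_nonneg hr0.le enorm_ne_top) hxI) h
  obtain ⟨V, U, hVU, hV, hU⟩ := exists_reducing_pair (μ := μ) hr0 hM hMN hfin
  let G : Ω → ℝ≥0∞ := fun y => ∑ i, ‖N y (V (EuclideanSpace.single i 1))‖ₑ
  have hG : AEMeasurable G μ := Finset.aemeasurable_fun_sum _ fun i _ => (hN _).enorm
  have hGtop : ∀ y, G y ≠ ⊤ := fun y => ENNReal.sum_ne_top.2 fun i _ => enorm_ne_top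
  have hc : (2 * n : ℝ≥0∞) ≠ ⊤ := by finiteness
  have hUM : ∀ᵐ x ∂μ, ‖U * M x‖ₑ ≤ 2 * n * I x ^ (1 / r) := by
    filter_upwards [hMs] with x hx
    refine ContinuousLinearMap.opENorm_le_bound _ fun v => ?_
    refine (hU (M x v)).trans ?_
    rw [mul_assoc (2 * n : ℝ≥0∞)]
    refine mul_le_mul_right ?_ _
    refine (ENNReal.rpow_le_rpow (lintegral_enorm_apply_rpow_le (μ := μ) hr0.le hNs hx v)
      (by positivity)).trans (le_of_eq ?_)
    rw [ENNReal.mul_rpow_of_nonneg _ _ (by positivity), ← ENNReal.rpow_mul,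
      mul_one_div_cancel hr0.ne', ENNReal.rpow_one, mul_comm]
  have hpoint : ∀ᵐ y ∂μ, ∫⁻ x, ‖M x * N y‖ₑ ^ q ∂μ ≤ (2 * n) ^ q * T * G y ^ q := by
    filter_upwards [hNs] with y hy
    have hcG : (2 * n) ^ q * G y ^ q ≠ ⊤ := ENNReal.mul_ne_top
      (ENNReal.rpow_ne_top_of_nonneg hq0.le hc) (ENNReal.rpow_ne_top_of_nonneg hq0.le (hGtop y))
    rw [mul_right_comm, hTdef, ← lintegral_const_mul' _ _ hcG]
    refine lintegral_mono_ae ?_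
    filter_upwards [hMs, hUM] with x hx hxU
    rw [← hqr, div_eq_mul_one_div, mul_comm q, ENNReal.rpow_mul,
      ← ENNReal.mul_rpow_of_nonneg _ _ hq0.le, ← ENNReal.mul_rpow_of_nonneg _ _ hq0.le]
    refine ENNReal.rpow_le_rpow ?_ hq0.le
    rw [enorm_mul_comm_of_isSelfAdjoint hx hy]
    calc ‖N y * M x‖ₑ = ‖(N y * V) * (U * M x)‖ₑ := by
          rw [mul_assoc, ← mul_assoc V, hVU, one_mul]
      _ ≤ ‖N y * V‖ₑ * ‖U * M x‖ₑ := by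
          simp only [← ofReal_norm]
          rw [← ENNReal.ofReal_mul (norm_nonneg _)]
          exact ENNReal.ofReal_le_ofReal (norm_mul_le _ _)
      _ ≤ G y * (2 * n * I x ^ (1 / r)) :=
          mul_le_mul' (enorm_le_sum_enorm_single _) hxU
      _ = 2 * n * G y * (∫⁻ y, ‖M x * N y‖ₑ ^ r ∂μ) ^ (1 / r) := by ring
  have hGr : ∫⁻ y, G y ^ r ∂μ ≤ n ^ r := by
    have hmeas : ∀ i ∈ (Finset.univ : Finset (Fin n)),
        AEMeasurable (fun y => ‖N y (V (EuclideanSpace.single i 1))‖ₑ ^ r) μ :=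
      fun i _ => (hN _).enorm.pow_const r
    calc ∫⁻ y, G y ^ r ∂μ
        ≤ ∫⁻ y, (n : ℝ≥0∞) ^ (r - 1) * ∑ i, ‖N y (V (EuclideanSpace.single i 1))‖ₑ ^ r ∂μ := by
          refine lintegral_mono fun y => ?_
          simpa using ENNReal.rpow_sum_le_const_mul_sum_rpow Finset.univ
            (fun i => ‖N y (V (EuclideanSpace.single i 1))‖ₑ) hr1.le
      _ = (n : ℝ≥0∞) ^ (r - 1) *
            ∑ i, ∫⁻ y, ‖N y (V (EuclideanSpace.single i 1))‖ₑ ^ r ∂μ := by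
          rw [lintegral_const_mul' _ _ (ENNReal.rpow_ne_top_of_nonneg (by linarith) (by simp)),
            lintegral_finsetSum' _ hmeas]
      _ ≤ (n : ℝ≥0∞) ^ (r - 1) * n := by
          refine mul_le_mul_right ?_ _
          simpa using Finset.sum_le_sum fun i (_ : i ∈ Finset.univ) => hV i
      _ = n ^ r := by
          conv_lhs => rw [← ENNReal.rpow_one (n : ℝ≥0∞), ← ENNReal.rpow_mul]
          rw [← ENNReal.rpow_add _ _ (by simp; omega) (by simp)]
          simp
  have hrp : 0 ≤ r / p := by positivity
  have hK : ((2 * n) ^ q * T) ^ (r / p) ≠ ⊤ := ENNReal.rpow_ne_top_of_nonneg hrp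
    (ENNReal.mul_ne_top (ENNReal.rpow_ne_top_of_nonneg hq0.le hc) hT)
  have hqp : q / p ≤ 1 := (div_le_one hp0).2 hp.le
  have hmain : ∫⁻ y, (∫⁻ x, ‖M x * N y‖ₑ ^ q ∂μ) ^ (r / p) ∂μ ≤
      ((2 * n) ^ q * T) ^ (r / p) * (n ^ r) ^ (q / p) := by
    calc ∫⁻ y, (∫⁻ x, ‖M x * N y‖ₑ ^ q ∂μ) ^ (r / p) ∂μ
        ≤ ∫⁻ y, ((2 * n) ^ q * T) ^ (r / p) * G y ^ (q * (r / p)) ∂μ := by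
          refine lintegral_mono_ae ?_
          filter_upwards [hpoint] with y hy
          rw [ENNReal.rpow_mul, ← ENNReal.mul_rpow_of_nonneg _ _ hrp]
          exact ENNReal.rpow_le_rpow hy hrp
      _ = ((2 * n) ^ q * T) ^ (r / p) * ∫⁻ y, G y ^ (q * (r / p)) ∂μ :=
          lintegral_const_mul' _ _ hK
      _ ≤ ((2 * n) ^ q * T) ^ (r / p) * (n ^ r) ^ (q / p) := by
          refine mul_le_mul_right ?_ _
          have hs : q * (r / p) = q / p * r := by ring
          have h := lintegral_rpow_le_rpow_lintegral (r := r) hG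
            (s := q * (r / p)) (by positivity) (by rw [hs]; nlinarith)
          refine h.trans ?_
          rw [hs, mul_div_cancel_right₀ _ hr0.ne']
          exact ENNReal.rpow_le_rpow hGr (by positivity)
  have h1n : (1 : ℝ≥0∞) ≤ n := by exact_mod_cast hn
  have h2n : (1 : ℝ≥0∞) ≤ 2 * n := by
    exact_mod_cast (by omega : 1 ≤ 2 * n)
  have hle1 : ∀ a : ℝ≥0∞, 1 ≤ a → a ^ (q / p) ≤ a := fun a ha =>
    (ENNReal.rpow_le_rpow_of_exponent_le ha hqp).trans_eq (ENNReal.rpow_one a)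
  have hr' : 0 ≤ 1 / r := by positivity
  calc _ ≤ (((2 * n) ^ q * T) ^ (r / p) * (n ^ r) ^ (q / p)) ^ (1 / r) :=
        ENNReal.rpow_le_rpow hmain hr'
    _ = (2 * n) ^ (q / p) * n ^ (q / p) * T ^ (1 / p) := by
        have e1 : r / p * (1 / r) = 1 / p := by field_simp
        have e2 : r * (q / p * (1 / r)) = q / p := by field_simp
        rw [ENNReal.mul_rpow_of_nonneg _ _ hr', ← ENNReal.rpow_mul _ (r / p), e1,
          ← ENNReal.rpow_mul _ (q / p), ← ENNReal.rpow_mul _ r, e2,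
          ENNReal.mul_rpow_of_nonneg _ _ (by positivity), ← ENNReal.rpow_mul, mul_one_div,
          mul_right_comm]
    _ ≤ 2 * n * n * T ^ (1 / p) :=
        mul_le_mul_left (mul_le_mul' (hle1 _ h2n) (hle1 _ h1n)) _
    _ = 2 * n ^ 2 * T ^ (1 / p) := by ring

end MixedAverage

/-- Mixed-average `A_q` estimate: the `q'`-average in `y` of the `p`-th root of the
`q`-average in `x` of `‖W^{1/q}(x)W^{-1/q}(y)‖^q` is at most `c [W]_{A_q}^{1/p}`. -/
theorem aq_mixed_average_bound (n : ℕ) (hn : 1 ≤ n) (q : ℝ) (hq : 1 < q) :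
    ∃ c : ℝ≥0∞, 0 < c ∧ c ≠ ⊤ ∧
      ∀ p : ℝ, q < p → ∀ (d : ℕ), 1 ≤ d →
        ∀ W : Rd d → Mat n, IsMatrixWeight W → AqConst W q ≠ ⊤ →
        ∀ Q : Cube d,
          ((volume Q.set)⁻¹ * ∫⁻ y in Q.set,
              ((volume Q.set)⁻¹ * ∫⁻ x in Q.set,
                ENNReal.ofReal (opNorm (matPow (W x) (1/q) * matPow (W y) (-(1/q)))) ^ q) ^
                ((q/(q-1))/p)) ^ ((q-1)/q) ≤
            c * AqConst W q ^ (1/p) := by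
  have hn' : (n : ℝ≥0∞) ≠ 0 := by exact_mod_cast (by omega : n ≠ 0)
  refine ⟨2 * n ^ 2, by positivity, by finiteness, fun p hp d _ W hW hA Q => ?_⟩
  set μ := (volume Q.set)⁻¹ • volume.restrict Q.set with hμ
  have : IsProbabilityMeasure μ := Q.isProbabilityMeasure
  have hac : μ ≪ volume :=
    Measure.AbsolutelyContinuous.smul_left Measure.restrict_le_self.absolutelyContinuous _
  have hpos : ∀ᵐ x ∂μ, (W x).PosDef := hac.ae_le hW.2
  have havg : ∀ f : Rd d → ℝ≥0∞, (volume Q.set)⁻¹ * ∫⁻ x in Q.set, f x = ∫⁻ x, f x ∂μ :=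
    fun f => by rw [hμ, lintegral_smul_measure, smul_eq_mul]
  let L := Matrix.toEuclideanCLM (𝕜 := ℂ) (n := Fin n)
  have hL : ∀ A B : Mat n, ENNReal.ofReal (opNorm (A * B)) = ‖L A * L B‖ₑ := fun A B => by
    rw [opNorm, map_mul, ofReal_norm]
  have hself : ∀ s : ℝ, ∀ᵐ x ∂μ, IsSelfAdjoint (L (matPow (W x) s)) := fun s => by
    filter_upwards [hpos] with x hx
    exact IsSelfAdjoint.map (isHermitian_matPow hx.isHermitian s).isSelfAdjoint L
  have hle : ∫⁻ x, (∫⁻ y, ‖L (matPow (W x) (1 / q)) * L (matPow (W y) (-(1 / q)))‖ₑ ^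
      (q / (q - 1)) ∂μ) ^ (q - 1) ∂μ ≤ AqConst W q := by
    refine le_trans (le_of_eq ?_) (le_iSup _ Q)
    simp only [havg, hL]
  simp only [havg, hL]
  refine (mixed_average_le hn hq hp
    (fun v => (hW.aemeasurable_matPow_apply _ v).mono_ac hac)
    (fun v => (hW.aemeasurable_matPow_apply _ v).mono_ac hac) (hself _) (hself _) ?_
    (ne_top_of_le_ne_top hA hle)).trans ?_
  · filter_upwards [hpos] with x hx
    rw [← map_mul, matPow_mul_matPow_neg hx, map_one]
  · have hp0 : 0 ≤ 1 / p := by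
      have : 0 < p := by linarith
      positivity
    exact mul_le_mul_right (ENNReal.rpow_le_rpow hle hp0) _

end
end
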